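/- arXiv:2210.12839 — 4 statements merged into one kernel-verified Lean document; each statement's English description precedes it below -/
import Mathlib

section
/- Suppose each f_i : \mathbb{R}^p\times\mathbb{R}^q \to \mathbb{R} is L_{f,0}-Lipschitz with L_{f,1}-Lipschitz gradient, and each g_i : \mathbb{R}^p\times\mathbb{R}^q \to \mathbb{R} has L_{g,1}-Lipschitz gradient, L_{g,2}-Lipschitz Hessian, and is \mu_g-strongly convex in y. Let g = (1/n)\sum_i g_i, y^*(x) = argmin_y g(x,y), and \Phi(x) = (1/n)\sum_i f_i(x, y^*(x)). Then \nabla\Phi is Lipschitz continuous with constant L_\Phi = L_{f,1} + (2 L_{f,1} L_{g,1} + L_{g,2} L_{f,0}^2)/\mu_g + (2 L_{g,1} L_{f,0} L_{g,2} + L_{g,1}^2 L_{f,1})/\mu_g^2 + L_{g,2} L_{g,1}^2 L_{f,0}/\mu_g^3. -/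
lemma hasFDerivAt_average {V W : Type*} [NormedAddCommGroup V] [NormedSpace ℝ V]
    [NormedAddCommGroup W] [NormedSpace ℝ W] {n : ℕ} {N : Fin n → V → W}
    (hN : ∀ i, Differentiable ℝ (N i)) (u : V) :
    HasFDerivAt (fun u => (1 / n : ℝ) • ∑ i, N i u) ((1 / n : ℝ) • ∑ i, fderiv ℝ (N i) u) u :=
  (HasFDerivAt.fun_sum fun i _ => (hN i u).hasFDerivAt).const_smul _

/-- The norm of an average is at most any common bound of the norms. -/
lemma norm_average_le {V : Type*} [NormedAddCommGroup V] [NormedSpace ℝ V] {n : ℕ} (hn : 0 < n)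
    {a : Fin n → V} {c : ℝ} (h : ∀ i, ‖a i‖ ≤ c) : ‖(1 / n : ℝ) • ∑ i, a i‖ ≤ c := by
  have hn' : (0 : ℝ) < n := by exact_mod_cast hn
  have hs : ‖∑ i, a i‖ ≤ n * c := by
    simpa using norm_sum_le_of_le (Finset.univ : Finset (Fin n)) (fun i _ => h i)
  rw [norm_smul, Real.norm_of_nonneg (by positivity)]
  calc (1 / n : ℝ) * ‖∑ i, a i‖ ≤ (1 / n : ℝ) * (n * c) := by gcongr
    _ = c := by field_simp

/-- An average is at least any common lower bound. -/
lemma le_average {n : ℕ} (hn : 0 < n) {t : Fin n → ℝ} {c : ℝ} (h : ∀ i, c ≤ t i) :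
    c ≤ (1 / n : ℝ) * ∑ i, t i := by
  have hn' : (0 : ℝ) < n := by exact_mod_cast hn
  rw [one_div, le_inv_mul_iff₀ hn']
  simpa using Finset.card_nsmul_le_sum Finset.univ t c fun i _ => h i

/-- The derivative of a differentiable convex function is monotone. -/
lemma ConvexOn.fderiv_monotone {V : Type*} [NormedAddCommGroup V] [NormedSpace ℝ V] {h : V → ℝ}
    (hc : ConvexOn ℝ Set.univ h) (hd : Differentiable ℝ h) (a b : V) :
    fderiv ℝ h b (a - b) ≤ fderiv ℝ h a (a - b) := by
  have hderiv : ∀ t : ℝ, HasDerivAt (fun t : ℝ => h (AffineMap.lineMap b a t))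
      (fderiv ℝ h (AffineMap.lineMap b a t) (a - b)) t := fun t =>
    (hd _).hasFDerivAt.comp_hasDerivAt t AffineMap.hasDerivAt_lineMap
  have hcl : ConvexOn ℝ Set.univ (fun t : ℝ => h (AffineMap.lineMap b a t)) := by
    simpa using! hc.comp_affineMap (AffineMap.lineMap b a : ℝ →ᵃ[ℝ] V)
  have hm := hcl.monotoneOn_deriv (fun t _ => (hderiv t).differentiableAt)
    (Set.mem_univ (0 : ℝ)) (Set.mem_univ (1 : ℝ)) zero_le_one
  rw [(hderiv 0).deriv, (hderiv 1).deriv] at hm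
  simpa using hm

section

variable {E F : Type*} [NormedAddCommGroup E] [NormedAddCommGroup F]

lemma norm_toLp_prod_le {c r : ℝ} {x : E} {y : F} (hx : ‖x‖ ≤ c) (hy : ‖y‖ ≤ r * c) :
    ‖WithLp.toLp 2 (x, y)‖ ≤ √(1 + r ^ 2) * c := by
  have hc : 0 ≤ c := (norm_nonneg x).trans hx
  refine le_of_sq_le_sq ?_ (by positivity)
  rw [WithLp.prod_norm_sq_eq_of_L2, mul_pow, Real.sq_sqrt (by positivity)]
  have h1 : ‖x‖ ^ 2 ≤ c ^ 2 := by gcongr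
  have h2 : ‖y‖ ^ 2 ≤ (r * c) ^ 2 := by gcongr
  simpa using (add_le_add h1 h2).trans_eq (by ring)

variable {G : WithLp 2 (E × F) → F} {y : E → F} {μ L M : ℝ}

/-- The zero `y x` of an expanding Lipschitz map `G (x, ·)` is Lipschitz in `x`. -/
lemma norm_implicit_sub_le (hμ : 0 < μ)
    (hexp : ∀ x a b, μ * ‖a - b‖ ≤ ‖G (WithLp.toLp 2 (x, a)) - G (WithLp.toLp 2 (x, b))‖)
    (hL : ∀ u v, ‖G u - G v‖ ≤ L * ‖u - v‖) (h0 : ∀ x, G (WithLp.toLp 2 (x, y x)) = 0)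
    (a b : E) : ‖y a - y b‖ ≤ L / μ * ‖a - b‖ := by
  have h1 := hexp b (y a) (y b)
  have h2 := hL (WithLp.toLp 2 (b, y a)) (WithLp.toLp 2 (a, y a))
  rw [h0] at h1 h2
  rw [← WithLp.toLp_sub, Prod.mk_sub_mk, sub_self, WithLp.norm_toLp_fst, norm_sub_rev b a] at h2
  rw [div_mul_eq_mul_div, le_div_iff₀ hμ, mul_comm]
  exact h1.trans h2

lemma norm_graph_sub_le (hμ : 0 < μ)
    (hexp : ∀ x a b, μ * ‖a - b‖ ≤ ‖G (WithLp.toLp 2 (x, a)) - G (WithLp.toLp 2 (x, b))‖)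
    (hL : ∀ u v, ‖G u - G v‖ ≤ L * ‖u - v‖) (h0 : ∀ x, G (WithLp.toLp 2 (x, y x)) = 0)
    (a b : E) : ‖WithLp.toLp 2 (a, y a) - WithLp.toLp 2 (b, y b)‖
      ≤ √(1 + (L / μ) ^ 2) * ‖a - b‖ := by
  rw [← WithLp.toLp_sub, Prod.mk_sub_mk]
  exact norm_toLp_prod_le le_rfl (norm_implicit_sub_le hμ hexp hL h0 a b)

variable [NormedSpace ℝ E] [NormedSpace ℝ F]

/-- The derivative of the graph map `x ↦ (x, y x)` when `y` has derivative `K`. -/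
noncomputable def graphDeriv (K : E →L[ℝ] F) : E →L[ℝ] WithLp 2 (E × F) :=
  (WithLp.prodContinuousLinearEquiv 2 ℝ E F).symm.toContinuousLinearMap ∘L
    (ContinuousLinearMap.id ℝ E).prod K

lemma graphDeriv_apply (K : E →L[ℝ] F) (v : E) : graphDeriv K v = WithLp.toLp 2 (v, K v) := rfl

lemma hasFDerivAt_graph {y : E → F} {K : E →L[ℝ] F} {x : E} (hK : HasFDerivAt y K x) :
    HasFDerivAt (fun x => WithLp.toLp 2 (x, y x)) (graphDeriv K) x :=
  (WithLp.prodContinuousLinearEquiv 2 ℝ E F).symm.hasFDerivAt.comp x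
    ((hasFDerivAt_id x).prodMk hK)

/-- If `G (x, ·)` expands distances by at least `μ`, so does its derivative. -/
lemma mul_norm_le_norm_fderiv (hG : Differentiable ℝ G)
    (hexp : ∀ x a b, μ * ‖a - b‖ ≤ ‖G (WithLp.toLp 2 (x, a)) - G (WithLp.toLp 2 (x, b))‖)
    (u : WithLp 2 (E × F)) (v : F) :
    μ * ‖v‖ ≤ ‖fderiv ℝ G u (WithLp.toLp 2 (0, v))‖ := by
  have hd : HasDerivAt (fun t : ℝ => G (u + t • WithLp.toLp 2 ((0 : E), v)))
      (fderiv ℝ G u (WithLp.toLp 2 (0, v))) 0 :=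
    ((hG u).hasFDerivAt.hasLineDerivAt _)
  refine ge_of_tendsto hd.tendsto_slope_zero.norm ?_
  filter_upwards [self_mem_nhdsWithin] with t ht
  have ht' : 0 < |t| := abs_pos.mpr ht
  have h := hexp u.fst (u.snd + t • v) u.snd
  have h1 : (WithLp.toLp 2 (u.fst, u.snd + t • v) : WithLp 2 (E × F))
      = u + t • WithLp.toLp 2 ((0 : E), v) := by
    apply (WithLp.equiv 2 (E × F)).injective
    ext <;> simp
  have h2 : (WithLp.toLp 2 (u.fst, u.snd) : WithLp 2 (E × F)) = u := rfl
  rw [h1, h2, add_sub_cancel_left, norm_smul, Real.norm_eq_abs] at h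
  rw [norm_smul, norm_inv, Real.norm_eq_abs, le_inv_mul_iff₀ ht']
  simpa [mul_left_comm] using h

/-- The implicit function `y` is differentiable. -/
lemma differentiable_implicit [FiniteDimensional ℝ F] (hμ : 0 < μ) (hG : Differentiable ℝ G)
    (hexp : ∀ x a b, μ * ‖a - b‖ ≤ ‖G (WithLp.toLp 2 (x, a)) - G (WithLp.toLp 2 (x, b))‖)
    (hL : ∀ u v, ‖G u - G v‖ ≤ L * ‖u - v‖) (h0 : ∀ x, G (WithLp.toLp 2 (x, y x)) = 0) :
    Differentiable ℝ y := by
  intro x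
  set D := fderiv ℝ G (WithLp.toLp 2 (x, y x)) with hD
  let e := (WithLp.prodContinuousLinearEquiv 2 ℝ E F).symm.toContinuousLinearMap
  let B : F →L[ℝ] F := D ∘L e ∘L ContinuousLinearMap.inr ℝ E F
  let C : E →L[ℝ] F := D ∘L e ∘L ContinuousLinearMap.inl ℝ E F
  have hB : ∀ v, μ * ‖v‖ ≤ ‖B v‖ := mul_norm_le_norm_fderiv hG hexp _
  have hinj : Function.Injective (B : F →ₗ[ℝ] F) := by
    refine (injective_iff_map_eq_zero _).mpr fun v hv => ?_
    have h := hB v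
    rw [show B v = 0 from hv, norm_zero] at h
    exact norm_le_zero_iff.mp (nonpos_of_mul_nonpos_right h hμ)
  let Be := (LinearEquiv.ofInjectiveEndo (B : F →ₗ[ℝ] F) hinj).toContinuousLinearEquiv
  let K : E →L[ℝ] F := -(Be.symm.toContinuousLinearMap ∘L C)
  have hBK : ∀ v, B (K v) = - C v := fun v => by
    have : B (Be.symm (C v)) = C v := Be.apply_symm_apply (C v)
    simp [K, this]
  refine HasFDerivAt.differentiableAt (f' := K) (HasFDerivAt.of_isLittleO ?_)
  have hz : (fun x' => WithLp.toLp 2 (x', y x') - WithLp.toLp 2 (x, y x))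
      =O[nhds x] fun x' => x' - x :=
    Asymptotics.IsBigO.of_bound _
      (Filter.Eventually.of_forall fun x' => norm_graph_sub_le hμ hexp hL h0 x' x)
  have hcont : Filter.Tendsto (fun x' => WithLp.toLp 2 (x', y x')) (nhds x)
      (nhds (WithLp.toLp 2 (x, y x))) := by
    rw [tendsto_iff_norm_sub_tendsto_zero]
    refine squeeze_zero (fun _ => norm_nonneg _)
      (fun x' => norm_graph_sub_le hμ hexp hL h0 x' x) ?_
    have : Continuous fun x' : E => √(1 + (L / μ) ^ 2) * ‖x' - x‖ := by fun_prop
    simpa using this.tendsto x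
  have hlo := ((hG (WithLp.toLp 2 (x, y x))).hasFDerivAt.isLittleO.comp_tendsto hcont).trans_isBigO
    hz
  refine Asymptotics.IsBigO.trans_isLittleO (Asymptotics.IsBigO.of_bound μ⁻¹
    (Filter.Eventually.of_forall fun x' => ?_)) hlo
  rw [le_inv_mul_iff₀ hμ]
  refine (hB _).trans_eq ?_
  have hsplit : D (WithLp.toLp 2 (x', y x') - WithLp.toLp 2 (x, y x))
      = C (x' - x) + B (y x' - y x) := by
    simp only [B, C, ContinuousLinearMap.comp_apply, ← map_add]
    congr 1
    apply (WithLp.equiv 2 (E × F)).injective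
    ext <;> simp [e]
  simp only [Function.comp_apply, h0, sub_self, zero_sub, norm_neg, ← hD]
  rw [hsplit, map_sub, hBK, sub_neg_eq_add, add_comm]

lemma norm_graphDeriv_le [FiniteDimensional ℝ F] (hμ : 0 < μ) (hG : Differentiable ℝ G)
    (hexp : ∀ x a b, μ * ‖a - b‖ ≤ ‖G (WithLp.toLp 2 (x, a)) - G (WithLp.toLp 2 (x, b))‖)
    (hL : ∀ u v, ‖G u - G v‖ ≤ L * ‖u - v‖) (h0 : ∀ x, G (WithLp.toLp 2 (x, y x)) = 0) (x : E) :
    ‖graphDeriv (fderiv ℝ y x)‖ ≤ √(1 + (L / μ) ^ 2) :=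
  (hasFDerivAt_graph (differentiable_implicit hμ hG hexp hL h0 x).hasFDerivAt).le_of_lip'
    (by positivity) (Filter.Eventually.of_forall fun x' => norm_graph_sub_le hμ hexp hL h0 x' x)

/-- The derivative of an implicit function is Lipschitz. -/
lemma norm_fderiv_implicit_sub_le [FiniteDimensional ℝ F] (hμ : 0 < μ) (hG : Differentiable ℝ G)
    (hM0 : 0 ≤ M)
    (hexp : ∀ x a b, μ * ‖a - b‖ ≤ ‖G (WithLp.toLp 2 (x, a)) - G (WithLp.toLp 2 (x, b))‖)
    (hL : ∀ u v, ‖G u - G v‖ ≤ L * ‖u - v‖)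
    (hM : ∀ u v, ‖fderiv ℝ G u - fderiv ℝ G v‖ ≤ M * ‖u - v‖)
    (h0 : ∀ x, G (WithLp.toLp 2 (x, y x)) = 0) (a b : E) :
    ‖fderiv ℝ y a - fderiv ℝ y b‖ ≤ M * (1 + (L / μ) ^ 2) / μ * ‖a - b‖ := by
  have hd := differentiable_implicit hμ hG hexp hL h0
  have hs : √(1 + (L / μ) ^ 2) * √(1 + (L / μ) ^ 2) = 1 + (L / μ) ^ 2 :=
    Real.mul_self_sqrt (by positivity)
  have hcomp : ∀ x v, fderiv ℝ G (WithLp.toLp 2 (x, y x)) (graphDeriv (fderiv ℝ y x) v) = 0 := by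
    intro x v
    have h := (hG (WithLp.toLp 2 (x, y x))).hasFDerivAt.comp x
      (hasFDerivAt_graph (hd x).hasFDerivAt)
    have hc : (G ∘ fun x => WithLp.toLp 2 (x, y x)) = fun _ => 0 := funext h0
    rw [hc] at h
    exact DFunLike.congr_fun (h.unique (hasFDerivAt_const 0 x)) v
  refine ContinuousLinearMap.opNorm_le_bound _ (by positivity) fun v => ?_
  set Da := fderiv ℝ G (WithLp.toLp 2 (a, y a)) with hDa
  set Db := fderiv ℝ G (WithLp.toLp 2 (b, y b)) with hDb
  have hdiff : WithLp.toLp 2 (0, (fderiv ℝ y a - fderiv ℝ y b) v)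
      = graphDeriv (fderiv ℝ y a) v - graphDeriv (fderiv ℝ y b) v := by
    simp [graphDeriv_apply, ← WithLp.toLp_sub]
  have hkey : Da (WithLp.toLp 2 (0, (fderiv ℝ y a - fderiv ℝ y b) v))
      = (Db - Da) (graphDeriv (fderiv ℝ y b) v) := by
    rw [hdiff, map_sub, hcomp, sub_apply, hcomp]
  have h1 : μ * ‖(fderiv ℝ y a - fderiv ℝ y b) v‖
      ≤ ‖(Db - Da) (graphDeriv (fderiv ℝ y b) v)‖ := by
    rw [← hkey]
    exact mul_norm_le_norm_fderiv hG hexp _ _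
  have h2 : ‖Db - Da‖ ≤ M * (√(1 + (L / μ) ^ 2) * ‖a - b‖) := by
    rw [norm_sub_rev]
    exact (hM _ _).trans (by gcongr; exact norm_graph_sub_le hμ hexp hL h0 a b)
  have h3 : ‖graphDeriv (fderiv ℝ y b) v‖ ≤ √(1 + (L / μ) ^ 2) * ‖v‖ :=
    ContinuousLinearMap.le_of_opNorm_le _ (norm_graphDeriv_le hμ hG hexp hL h0 b) v
  have h4 := h1.trans (((Db - Da).le_opNorm _).trans
    (mul_le_mul h2 h3 (norm_nonneg _) (by positivity)))
  rw [div_mul_eq_mul_div, div_mul_eq_mul_div, le_div_iff₀ hμ, mul_comm _ μ, ← hs]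
  exact h4.trans_eq (by ring)

lemma fderiv_comp_implicit_sub_le [FiniteDimensional ℝ F] (hμ : 0 < μ) (hL0 : 0 < L)
    (hM0 : 0 ≤ M) (hG : Differentiable ℝ G)
    (hexp : ∀ x a b, μ * ‖a - b‖ ≤ ‖G (WithLp.toLp 2 (x, a)) - G (WithLp.toLp 2 (x, b))‖)
    (hL : ∀ u v, ‖G u - G v‖ ≤ L * ‖u - v‖)
    (hM : ∀ u v, ‖fderiv ℝ G u - fderiv ℝ G v‖ ≤ M * ‖u - v‖)
    (h0 : ∀ x, G (WithLp.toLp 2 (x, y x)) = 0)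
    {f : WithLp 2 (E × F) → ℝ} {A B : ℝ} (hB0 : 0 ≤ B) (hf : Differentiable ℝ f)
    (hA : ∀ u, ‖fderiv ℝ f u‖ ≤ A) (hB : ∀ u v, ‖fderiv ℝ f u - fderiv ℝ f v‖ ≤ B * ‖u - v‖)
    (a b : E) :
    ‖fderiv ℝ (fun x => f (WithLp.toLp 2 (x, y x))) a
        - fderiv ℝ (fun x => f (WithLp.toLp 2 (x, y x))) b‖
      ≤ (B * (1 + (L / μ) ^ 2) + A * (M * (2 * (L / μ) + (L / μ) ^ 2) / μ)) * ‖a - b‖ := by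
  have hd := differentiable_implicit hμ hG hexp hL h0
  have hs : √(1 + (L / μ) ^ 2) * √(1 + (L / μ) ^ 2) = 1 + (L / μ) ^ 2 :=
    Real.mul_self_sqrt (by positivity)
  have hA0 : 0 ≤ A := (norm_nonneg _).trans (hA 0)
  have hfd : ∀ x, fderiv ℝ (fun x => f (WithLp.toLp 2 (x, y x))) x
      = fderiv ℝ f (WithLp.toLp 2 (x, y x)) ∘L graphDeriv (fderiv ℝ y x) := fun x =>
    ((hf _).hasFDerivAt.comp x (hasFDerivAt_graph (hd x).hasFDerivAt)).fderiv
  have hy : ‖fderiv ℝ y a - fderiv ℝ y b‖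
      ≤ M * (2 * (L / μ) + (L / μ) ^ 2) / μ * ‖a - b‖ := by
    rcases subsingleton_or_nontrivial F with hF | hF
    · rw [Subsingleton.elim (fderiv ℝ y a - fderiv ℝ y b) 0, norm_zero]
      positivity
    · obtain ⟨v, hv⟩ := exists_ne (0 : F)
      have h1 := (hexp 0 v 0).trans (hL _ _)
      rw [← WithLp.toLp_sub, Prod.mk_sub_mk, sub_self, sub_zero, WithLp.norm_toLp_snd]
        at h1
      have h2 : 1 ≤ L / μ :=
        (one_le_div hμ).mpr (le_of_mul_le_mul_right h1 (norm_pos_iff.mpr hv))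
      refine (norm_fderiv_implicit_sub_le hμ hG hM0 hexp hL hM h0 a b).trans ?_
      gcongr
      linarith
  have hg : ‖graphDeriv (fderiv ℝ y a) - graphDeriv (fderiv ℝ y b)‖
      ≤ ‖fderiv ℝ y a - fderiv ℝ y b‖ := by
    refine ContinuousLinearMap.opNorm_le_bound _ (norm_nonneg _) fun v => ?_
    have h : (graphDeriv (fderiv ℝ y a) - graphDeriv (fderiv ℝ y b)) v
        = WithLp.toLp 2 (0, (fderiv ℝ y a - fderiv ℝ y b) v) := by
      simp [graphDeriv_apply, ← WithLp.toLp_sub]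
    rw [h, WithLp.norm_toLp_snd]
    exact ContinuousLinearMap.le_opNorm _ _
  have hsplit : ∀ (P Q : WithLp 2 (E × F) →L[ℝ] ℝ) (R S : E →L[ℝ] WithLp 2 (E × F)),
      P ∘L R - Q ∘L S = (P - Q) ∘L R + Q ∘L (R - S) := fun P Q R S => by
    ext v
    simp
  rw [hfd, hfd, hsplit]
  refine (norm_add_le _ _).trans ?_
  rw [add_mul]
  refine add_le_add ?_ ?_
  · refine (ContinuousLinearMap.opNorm_comp_le _ _).trans ((mul_le_mul ((hB _ _).trans
      (mul_le_mul_of_nonneg_left (norm_graph_sub_le hμ hexp hL h0 a b) hB0))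
      (norm_graphDeriv_le hμ hG hexp hL h0 a) (norm_nonneg _) (by positivity)).trans_eq ?_)
    linear_combination B * ‖a - b‖ * hs
  · refine (ContinuousLinearMap.opNorm_comp_le _ _).trans ((mul_le_mul (hA _) (hg.trans hy)
      (norm_nonneg _) hA0).trans_eq ?_)
    ring

end

section

variable {V E F : Type*} [NormedAddCommGroup V] [InnerProductSpace ℝ V] [CompleteSpace V]
  [NormedAddCommGroup E] [InnerProductSpace ℝ E] [CompleteSpace E]
  [NormedAddCommGroup F] [InnerProductSpace ℝ F] [CompleteSpace F]

lemma norm_gradient_sub (f : V → ℝ) (u v : V) :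
    ‖gradient f u - gradient f v‖ = ‖fderiv ℝ f u - fderiv ℝ f v‖ := by
  rw [← toDual_gradient, ← toDual_gradient, ← map_sub, LinearIsometryEquiv.norm_map]

lemma ContDiff.differentiable_gradient {f : V → ℝ} (hf : ContDiff ℝ 2 f) :
    Differentiable ℝ (gradient f) :=
  (InnerProductSpace.toDual ℝ V).symm.toContinuousLinearEquiv.differentiable.comp
    ((hf.fderiv_right (m := 1) (by norm_num)).differentiable one_ne_zero)

/-- The partial gradient in the second variable is the second component of the gradient. -/
lemma hasGradientAt_partial {g : WithLp 2 (E × F) → ℝ} (hg : Differentiable ℝ g) (x : E) (y : F) :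
    HasGradientAt (fun y => g (WithLp.toLp 2 (x, y))) (gradient g (WithLp.toLp 2 (x, y))).snd y := by
  have h := (hg (WithLp.toLp 2 (x, y))).hasFDerivAt.comp y
    ((WithLp.prodContinuousLinearEquiv 2 ℝ E F).symm.hasFDerivAt.comp y
      (hasFDerivAt_prodMk_right x y))
  rw [hasGradientAt_iff_hasFDerivAt]
  refine h.congr_fderiv ?_
  ext w
  have hw := DFunLike.congr_fun (toDual_gradient (f := g) (x := WithLp.toLp 2 (x, y)))
    (WithLp.toLp 2 ((0 : E), w))
  rw [InnerProductSpace.toDual_apply_apply, WithLp.prod_inner_apply] at hw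
  simpa using hw.symm

/-- Strong convexity in the second variable makes the partial gradient strongly monotone. -/
lemma partial_gradient_strong_monotone {g : WithLp 2 (E × F) → ℝ} {μ : ℝ}
    (hg : Differentiable ℝ g) {x : E}
    (hc : ConvexOn ℝ Set.univ fun y : F => g (WithLp.toLp 2 (x, y)) - μ / 2 * ‖y‖ ^ 2) (a b : F) :
    μ * ‖a - b‖ ^ 2 ≤ inner ℝ ((gradient g (WithLp.toLp 2 (x, a))).snd
      - (gradient g (WithLp.toLp 2 (x, b))).snd) (a - b) := by
  have hd : ∀ y : F, HasFDerivAt (fun y : F => g (WithLp.toLp 2 (x, y)) - μ / 2 * ‖y‖ ^ 2)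
      (InnerProductSpace.toDual ℝ F (gradient g (WithLp.toLp 2 (x, y))).snd
        - (μ / 2) • (2 • innerSL ℝ y)) y := fun y =>
    (hasGradientAt_partial hg x y).hasFDerivAt.sub
      ((hasStrictFDerivAt_norm_sq y).hasFDerivAt.const_mul (μ / 2))
  have h := hc.fderiv_monotone (fun y => (hd y).differentiableAt) a b
  rw [(hd a).fderiv, (hd b).fderiv] at h
  rw [inner_sub_left, ← real_inner_self_eq_norm_sq, inner_sub_left a b]
  simp at h
  linarith

lemma gradient_average {n : ℕ} {f : Fin n → V → ℝ} (hf : ∀ i, Differentiable ℝ (f i)) :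
    gradient (fun u => (1 / n : ℝ) * ∑ i, f i u)
      = fun u => (1 / n : ℝ) • ∑ i, gradient (f i) u := by
  refine gradient_eq fun u => ?_
  rw [hasGradientAt_iff_hasFDerivAt]
  refine (hasFDerivAt_average hf u).congr_fderiv ?_
  simp [toDual_gradient]

lemma hasFDerivAt_gradient_average {n : ℕ} {f : Fin n → V → ℝ} (hf : ∀ i, ContDiff ℝ 2 (f i))
    (u : V) : HasFDerivAt (gradient fun u => (1 / n : ℝ) * ∑ i, f i u)
      ((1 / n : ℝ) • ∑ i, fderiv ℝ (gradient (f i)) u) u := by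
  rw [gradient_average fun i => (hf i).differentiable two_ne_zero]
  exact hasFDerivAt_average (fun i => (hf i).differentiable_gradient) u

lemma norm_fderiv_gradient_average_sub_le {n : ℕ} (hn : 0 < n) {f : Fin n → V → ℝ}
    (hf : ∀ i, ContDiff ℝ 2 (f i)) {u v : V} {c : ℝ}
    (h : ∀ i, ‖fderiv ℝ (gradient (f i)) u - fderiv ℝ (gradient (f i)) v‖ ≤ c) :
    ‖fderiv ℝ (gradient fun u => (1 / n : ℝ) * ∑ i, f i u) u
      - fderiv ℝ (gradient fun u => (1 / n : ℝ) * ∑ i, f i u) v‖ ≤ c := by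
  rw [(hasFDerivAt_gradient_average hf u).fderiv, (hasFDerivAt_gradient_average hf v).fderiv,
    ← smul_sub, ← Finset.sum_sub_distrib]
  exact norm_average_le hn h

/-- The gradient of `x ↦ f (x, y x)` is Lipschitz, where `y x` minimizes the average of the
strongly convex functions `g i (x, ·)` and `f` is the average of the `f i`. -/
theorem gradient_average_comp_argmin_sub_le [FiniteDimensional ℝ F] {n : ℕ} (hn : 0 < n)
    {μ A B L M : ℝ} (hμ : 0 < μ) (hA0 : 0 ≤ A) (hB0 : 0 ≤ B) (hL0 : 0 < L) (hM0 : 0 ≤ M)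
    {fi gi : Fin n → WithLp 2 (E × F) → ℝ}
    (hfC1 : ∀ i, ContDiff ℝ 1 (fi i)) (hgC2 : ∀ i, ContDiff ℝ 2 (gi i))
    (hf0 : ∀ i u v, |fi i u - fi i v| ≤ A * ‖u - v‖)
    (hf1 : ∀ i u v, ‖gradient (fi i) u - gradient (fi i) v‖ ≤ B * ‖u - v‖)
    (hg1 : ∀ i u v, ‖gradient (gi i) u - gradient (gi i) v‖ ≤ L * ‖u - v‖)
    (hg2 : ∀ i u v, ‖fderiv ℝ (gradient (gi i)) u - fderiv ℝ (gradient (gi i)) v‖ ≤ M * ‖u - v‖)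
    (hsc : ∀ i x, ConvexOn ℝ Set.univ
      fun y : F => gi i (WithLp.toLp 2 (x, y)) - μ / 2 * ‖y‖ ^ 2)
    {y : E → F}
    (hmin : ∀ x b, (1 / n : ℝ) * ∑ i, gi i (WithLp.toLp 2 (x, y x))
      ≤ (1 / n : ℝ) * ∑ i, gi i (WithLp.toLp 2 (x, b))) (x1 x2 : E) :
    ‖gradient (fun x => (1 / n : ℝ) * ∑ i, fi i (WithLp.toLp 2 (x, y x))) x1
        - gradient (fun x => (1 / n : ℝ) * ∑ i, fi i (WithLp.toLp 2 (x, y x))) x2‖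
      ≤ (B * (1 + (L / μ) ^ 2) + A * (M * (2 * (L / μ) + (L / μ) ^ 2) / μ)) * ‖x1 - x2‖ := by
  have hgi : ∀ i, Differentiable ℝ (gi i) := fun i => (hgC2 i).differentiable two_ne_zero
  have hfi : ∀ i, Differentiable ℝ (fi i) := fun i => (hfC1 i).differentiable one_ne_zero
  let g := fun u => (1 / n : ℝ) * ∑ i, gi i u
  let f := fun u => (1 / n : ℝ) * ∑ i, fi i u
  have hgd : Differentiable ℝ g := fun u => (hasFDerivAt_average hgi u).differentiableAt
  have hfd : Differentiable ℝ f := fun u => (hasFDerivAt_average hfi u).differentiableAt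
  have hgg : gradient g = fun u => (1 / n : ℝ) • ∑ i, gradient (gi i) u := gradient_average hgi
  have hfg : gradient f = fun u => (1 / n : ℝ) • ∑ i, gradient (fi i) u := gradient_average hfi
  have hggd : Differentiable ℝ (gradient g) := fun u =>
    (hasFDerivAt_gradient_average hgC2 u).differentiableAt
  let S := WithLp.sndL 2 ℝ E F
  have hS : ‖S‖ ≤ 1 := S.opNorm_le_bound zero_le_one fun u => by
    simpa [S] using WithLp.norm_snd_le _ u
  have hGL : ∀ u v, ‖S (gradient g u) - S (gradient g v)‖ ≤ L * ‖u - v‖ := fun u v => by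
    rw [← map_sub]
    refine (S.le_of_opNorm_le hS _).trans ?_
    rw [one_mul, hgg, ← smul_sub, ← Finset.sum_sub_distrib]
    exact norm_average_le hn fun i => hg1 i u v
  have hSd : ∀ u, HasFDerivAt (fun u => S (gradient g u)) (S ∘L fderiv ℝ (gradient g) u) u :=
    fun u => S.hasFDerivAt.comp u (hggd u).hasFDerivAt
  have hGM : ∀ u v, ‖fderiv ℝ (fun u => S (gradient g u)) u
      - fderiv ℝ (fun u => S (gradient g u)) v‖ ≤ M * ‖u - v‖ := fun u v => by
    rw [(hSd u).fderiv, (hSd v).fderiv, ← ContinuousLinearMap.comp_sub]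
    refine (ContinuousLinearMap.opNorm_comp_le _ _).trans
      ((mul_le_of_le_one_left (norm_nonneg _) hS).trans ?_)
    exact norm_fderiv_gradient_average_sub_le hn hgC2 fun i => hg2 i u v
  have hexp : ∀ x a b, μ * ‖a - b‖ ≤ ‖S (gradient g (WithLp.toLp 2 (x, a)))
      - S (gradient g (WithLp.toLp 2 (x, b)))‖ := fun x a b => by
    have hmono : μ * ‖a - b‖ ^ 2 ≤ inner ℝ (S (gradient g (WithLp.toLp 2 (x, a)))
        - S (gradient g (WithLp.toLp 2 (x, b)))) (a - b) := by
      simp only [hgg, map_smul, map_sum, ← smul_sub, ← Finset.sum_sub_distrib,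
        real_inner_smul_left, sum_inner]
      exact le_average hn fun i => partial_gradient_strong_monotone (hgi i) (hsc i x) a b
    rcases (norm_nonneg (a - b)).eq_or_lt with h | h
    · rw [← h, mul_zero]
      exact norm_nonneg _
    · refine le_of_mul_le_mul_right ?_ h
      rw [mul_assoc, ← sq]
      exact hmono.trans (real_inner_le_norm _ _)
  have h0 : ∀ x, S (gradient g (WithLp.toLp 2 (x, y x))) = 0 := fun x => by
    have hloc : IsLocalMin (fun y => g (WithLp.toLp 2 (x, y))) (y x) :=
      Filter.Eventually.of_forall (hmin x)
    have h := hloc.hasFDerivAt_eq_zero (hasGradientAt_partial hgd x (y x)).hasFDerivAt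
    simpa [S] using h
  have hA : ∀ u, ‖fderiv ℝ f u‖ ≤ A := fun u => by
    refine norm_fderiv_le_of_lip' ℝ hA0 (Filter.Eventually.of_forall fun v => ?_)
    simp only [f, ← mul_sub, ← Finset.sum_sub_distrib]
    exact norm_average_le hn fun i => hf0 i v u
  have hB : ∀ u v, ‖fderiv ℝ f u - fderiv ℝ f v‖ ≤ B * ‖u - v‖ := fun u v => by
    rw [← norm_gradient_sub, hfg, ← smul_sub, ← Finset.sum_sub_distrib]
    exact norm_average_le hn fun i => hf1 i u v
  rw [norm_gradient_sub]
  exact fderiv_comp_implicit_sub_le hμ hL0 hM0 (fun u => (hSd u).differentiableAt) hexp hGL hGM h0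
    hB0 hfd hA hB x1 x2

end

/-- Smoothness of the hyperobjective: under Lipschitz assumptions on `f_i`, `∇f_i`, `∇g_i`,
`∇²g_i` and `μ_g`-strong convexity of each `g_i` in `y`, the gradient of
`Φ(x) = (1/n) ∑ᵢ f_i(x, y*(x))` is Lipschitz with the explicit constant `L_Φ`. -/
theorem stmt_3 (p q n : ℕ) (hn : 0 < n)
    (μg Lf0 Lf1 Lg1 Lg2 : ℝ)
    (hμ : 0 < μg) (hLf0 : 0 < Lf0) (hLf1 : 0 < Lf1) (hLg1 : 0 < Lg1) (hLg2 : 0 < Lg2)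
    (fi gi : Fin n →
      WithLp 2 (EuclideanSpace ℝ (Fin p) × EuclideanSpace ℝ (Fin q)) → ℝ)
    (hfC1 : ∀ i, ContDiff ℝ 1 (fi i)) (hgC2 : ∀ i, ContDiff ℝ 2 (gi i))
    (hf0 : ∀ i u v, |fi i u - fi i v| ≤ Lf0 * ‖u - v‖)
    (hf1 : ∀ i u v, ‖gradient (fi i) u - gradient (fi i) v‖ ≤ Lf1 * ‖u - v‖)
    (hg1 : ∀ i u v, ‖gradient (gi i) u - gradient (gi i) v‖ ≤ Lg1 * ‖u - v‖)
    (hg2 : ∀ i u v,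
      ‖fderiv ℝ (fun w => gradient (gi i) w) u - fderiv ℝ (fun w => gradient (gi i) w) v‖
        ≤ Lg2 * ‖u - v‖)
    (hsc : ∀ i (x : EuclideanSpace ℝ (Fin p)),
      ConvexOn ℝ Set.univ (fun y : EuclideanSpace ℝ (Fin q) =>
        gi i ((WithLp.equiv 2 (EuclideanSpace ℝ (Fin p) × EuclideanSpace ℝ (Fin q))).symm (x, y))
          - μg / 2 * ‖y‖ ^ 2))
    (g : WithLp 2 (EuclideanSpace ℝ (Fin p) × EuclideanSpace ℝ (Fin q)) → ℝ)
    (hg : ∀ u, g u = (1 / n : ℝ) * ∑ i, gi i u)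
    (ystar : EuclideanSpace ℝ (Fin p) → EuclideanSpace ℝ (Fin q))
    (hmin : ∀ x y,
      g ((WithLp.equiv 2 (EuclideanSpace ℝ (Fin p) × EuclideanSpace ℝ (Fin q))).symm (x, ystar x))
        ≤ g ((WithLp.equiv 2 (EuclideanSpace ℝ (Fin p) × EuclideanSpace ℝ (Fin q))).symm (x, y)))
    (Φ : EuclideanSpace ℝ (Fin p) → ℝ)
    (hΦ : ∀ x, Φ x = (1 / n : ℝ) * ∑ i, fi i
      ((WithLp.equiv 2 (EuclideanSpace ℝ (Fin p) × EuclideanSpace ℝ (Fin q))).symm (x, ystar x))) :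
    ∀ x1 x2, ‖gradient Φ x1 - gradient Φ x2‖ ≤
      (Lf1 + (2 * Lf1 * Lg1 + Lg2 * Lf0 ^ 2) / μg
        + (2 * Lg1 * Lf0 * Lg2 + Lg1 ^ 2 * Lf1) / μg ^ 2
        + Lg2 * Lg1 ^ 2 * Lf0 / μg ^ 3) * ‖x1 - x2‖ := by
  obtain rfl := funext hg
  obtain rfl := funext hΦ
  intro x1 x2
  refine (gradient_average_comp_argmin_sub_le hn hμ hLf0.le hLf1.le hLg1 hLg2.le hfC1 hgC2 hf0 hf1
    hg1 hg2 hsc hmin x1 x2).trans (mul_le_mul_of_nonneg_right ?_ (norm_nonneg _))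
  have h : 0 ≤ 2 * Lf1 * Lg1 / μg + Lg2 * Lf0 ^ 2 / μg := by positivity
  refine (le_add_of_nonneg_right h).trans_eq ?_
  field_simp
  ring
end

section
/- Let W = (w_{ij}) \in \mathbb{R}^{n\times n} be symmetric, doubly stochastic with nonnegative entries, with eigenvalues 1 = \lambda_1 > \lambda_2 \ge \dots \ge \lambda_n and \rho := max(|\lambda_2|, |\lambda_n|), 0 < \rho < 1. Let X, S \in \mathbb{R}^{p\times n}, \alpha \in \mathbb{R}, and set X' = XW - \alpha S. Write \bar{x} = (1/n)X\mathbf{1}_n, \bar{x}' = (1/n)X'\mathbf{1}_n, \bar{s} = (1/n)S\mathbf{1}_n. Then \|X' - \bar{x}'\mathbf{1}_n^T\|_F^2 \le \frac{1+\rho^2}{2}\|X - \bar{x}\mathbf{1}_n^T\|_F^2 + \alpha^2 \frac{1+\rho^2}{1-\rho^2}\|S - \bar{s}\mathbf{1}_n^T\|_F^2. -/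
/-- Squared Frobenius norm of a real matrix. -/
noncomputable def sqFrob {m n : ℕ} (A : Matrix (Fin m) (Fin n) ℝ) : ℝ :=
  ∑ i, ∑ j, A i j ^ 2

open Matrix in
/-- In an orthonormal eigenbasis, a symmetric real matrix multiplies coordinates by eigenvalues. -/
lemma inner_eigenvectorBasis_mulVec {n : ℕ} {W : Matrix (Fin n) (Fin n) ℝ}
    (hW : W.IsHermitian) (v : Fin n → ℝ) (i : Fin n) :
    inner ℝ (hW.eigenvectorBasis i) (WithLp.toLp 2 (W *ᵥ v)) =
      hW.eigenvalues i * inner ℝ (hW.eigenvectorBasis i) (WithLp.toLp 2 v) := by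
  have hT : Wᵀ = W := by
    ext j k; simpa using hW.apply j k
  have key : (hW.eigenvectorBasis i).ofLp ⬝ᵥ (W *ᵥ v) =
      hW.eigenvalues i * ((hW.eigenvectorBasis i).ofLp ⬝ᵥ v) := by
    rw [dotProduct_mulVec, ← mulVec_transpose, hT, hW.mulVec_eigenvectorBasis, smul_dotProduct,
      smul_eq_mul]
  simpa [EuclideanSpace.inner_eq_star_dotProduct, dotProduct_comm] using key

open Matrix in
/-- A symmetric matrix fixing the all-ones vector contracts the sum-zero subspace by `ρ`, where
`ρ` bounds all eigenvalues but one. -/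
lemma sum_sq_mulVec_le {n : ℕ} {W : Matrix (Fin n) (Fin n) ℝ} (hW : W.IsHermitian)
    (hrow : ∀ i, ∑ j, W i j = 1) (i₀ : Fin n) {ρ : ℝ}
    (hgap : ∀ i, i ≠ i₀ → hW.eigenvalues i < 1)
    (hρ : ∀ i, i ≠ i₀ → |hW.eigenvalues i| ≤ ρ) (v : Fin n → ℝ) (hv : ∑ j, v j = 0) :
    ∑ j, (W *ᵥ v) j ^ 2 ≤ ρ ^ 2 * ∑ j, v j ^ 2 := by
  set b := hW.eigenvectorBasis
  have hone : W *ᵥ (fun _ => (1 : ℝ)) = fun _ => 1 := by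
    ext i; simp [mulVec, dotProduct, hrow]
  have parseval (u : Fin n → ℝ) : ∑ j, u j ^ 2 = ∑ i, inner ℝ (b i) (WithLp.toLp 2 u) ^ 2 := by
    have h := b.sum_sq_norm_inner_right (WithLp.toLp 2 u)
    simpa [EuclideanSpace.norm_sq_eq] using h.symm
  have orth : ∀ i, i ≠ i₀ → inner ℝ (b i) (WithLp.toLp 2 fun _ : Fin n => (1 : ℝ)) = 0 := by
    intro i hi
    have h := inner_eigenvectorBasis_mulVec hW (fun _ => (1 : ℝ)) i
    rw [hone] at h
    have h' : (hW.eigenvalues i - 1) *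
        inner ℝ (b i) (WithLp.toLp 2 fun _ : Fin n => (1 : ℝ)) = 0 := by
      linarith
    exact (mul_eq_zero.mp h').resolve_left (by linarith [hgap i hi])
  have hc : inner ℝ (b i₀) (WithLp.toLp 2 fun _ : Fin n => (1 : ℝ)) ≠ 0 := by
    intro h0
    have h := parseval fun _ => (1 : ℝ)
    have hz : ∑ i, inner ℝ (b i) (WithLp.toLp 2 fun _ : Fin n => (1 : ℝ)) ^ 2 = 0 := by
      refine Finset.sum_eq_zero fun i _ => ?_
      by_cases hi : i = i₀
      · rw [hi, h0, sq, zero_mul]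
      · rw [orth i hi, sq, zero_mul]
    rw [hz] at h
    have : n = 0 := by simpa using h
    exact absurd i₀.pos (by omega)
  have hv0 : inner ℝ (b i₀) (WithLp.toLp 2 v) = 0 := by
    have h := b.sum_inner_mul_inner (WithLp.toLp 2 fun _ : Fin n => (1 : ℝ)) (WithLp.toLp 2 v)
    rw [Finset.sum_eq_single i₀ (fun i _ hi => by
      rw [real_inner_comm, orth i hi, zero_mul]) (by simp), real_inner_comm] at h
    have h1 : inner ℝ (WithLp.toLp 2 fun _ : Fin n => (1 : ℝ)) (WithLp.toLp 2 v) = 0 := by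
      simpa [PiLp.inner_apply] using hv
    rw [h1] at h
    exact (mul_eq_zero.mp h).resolve_left hc
  rw [parseval, parseval v, Finset.mul_sum]
  refine Finset.sum_le_sum fun i _ => ?_
  rw [inner_eigenvectorBasis_mulVec hW v i]
  by_cases hi : i = i₀
  · subst hi
    change (_ * inner ℝ (b i) _) ^ 2 ≤ _
    rw [hv0]; simp
  · rw [mul_pow]
    exact mul_le_mul_of_nonneg_right
      (sq_le_sq.mpr ((hρ i hi).trans (le_abs_self ρ))) (sq_nonneg _)

/-- Young's inequality with the weights that balance a contraction by `ρ`. -/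
lemma sub_sq_le_weighted {ρ : ℝ} (hρ0 : 0 < ρ) (hρ1 : ρ < 1) (y z : ℝ) :
    (y - z) ^ 2 ≤ (1 + ρ ^ 2) / (2 * ρ ^ 2) * y ^ 2 + (1 + ρ ^ 2) / (1 - ρ ^ 2) * z ^ 2 := by
  have h1 : 0 < 1 - ρ ^ 2 := by nlinarith
  have h : (1 + ρ ^ 2) / (2 * ρ ^ 2) * y ^ 2 + (1 + ρ ^ 2) / (1 - ρ ^ 2) * z ^ 2 - (y - z) ^ 2 =
      ((1 - ρ ^ 2) * y + 2 * ρ ^ 2 * z) ^ 2 / (2 * ρ ^ 2 * (1 - ρ ^ 2)) := by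
    field_simp
    ring
  have : 0 ≤ ((1 - ρ ^ 2) * y + 2 * ρ ^ 2 * z) ^ 2 / (2 * ρ ^ 2 * (1 - ρ ^ 2)) := by positivity
  linarith

/-- One-step consensus contraction for a gradient-tracking-type update `X' = XW - αS`
with a symmetric doubly stochastic mixing matrix of spectral gap `ρ ∈ (0,1)`:
`‖X' - x̄'𝟙ᵀ‖_F² ≤ (1+ρ²)/2 ‖X - x̄𝟙ᵀ‖_F² + α²(1+ρ²)/(1-ρ²) ‖S - s̄𝟙ᵀ‖_F²`. -/
theorem stmt_7 (n p : ℕ) (W : Matrix (Fin n) (Fin n) ℝ)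
    (hnn : ∀ i j, 0 ≤ W i j)
    (hrow : ∀ i, ∑ j, W i j = 1) (hcol : ∀ j, ∑ i, W i j = 1)
    (hherm : W.IsHermitian)
    (i₀ : Fin n) (htop : hherm.eigenvalues i₀ = 1)
    (hgap : ∀ i, i ≠ i₀ → hherm.eigenvalues i < 1)
    (ρ : ℝ) (hρ0 : 0 < ρ) (hρ : ∀ i, i ≠ i₀ → |hherm.eigenvalues i| ≤ ρ) (hρ1 : ρ < 1)
    (X S : Matrix (Fin p) (Fin n) ℝ) (α : ℝ) :
    sqFrob ((X * W - α • S) -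
        Matrix.of fun i _ => (1 / n : ℝ) * ∑ j, (X * W - α • S) i j) ≤
      (1 + ρ ^ 2) / 2 * sqFrob (X - Matrix.of fun i _ => (1 / n : ℝ) * ∑ j, X i j) +
        α ^ 2 * ((1 + ρ ^ 2) / (1 - ρ ^ 2)) *
          sqFrob (S - Matrix.of fun i _ => (1 / n : ℝ) * ∑ j, S i j) := by
  have hn : (n : ℝ) ≠ 0 := by
    have := i₀.pos
    positivity
  unfold sqFrob
  rw [Finset.mul_sum, Finset.mul_sum, ← Finset.sum_add_distrib]
  refine Finset.sum_le_sum fun i _ => ?_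
  set u : Fin n → ℝ := fun j => X i j - 1 / n * ∑ k, X i k with hu
  set t : Fin n → ℝ := fun j => S i j - 1 / n * ∑ k, S i k with ht
  have hu0 : ∑ j, u j = 0 := by
    simp [hu, Finset.sum_sub_distrib]
    field_simp
    ring
  have hsymm : ∀ j k, W j k = W k j := fun j k => by simpa using hherm.apply k j
  have hsum : ∑ j, (X * W) i j = ∑ k, X i k := by
    simp only [Matrix.mul_apply]
    rw [Finset.sum_comm]
    simp [← Finset.mul_sum, hrow]
  have hmul : ∀ j, W.mulVec u j = (X * W) i j - 1 / n * ∑ k, X i k := by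
    intro j
    simp only [Matrix.mulVec, dotProduct, hu, Matrix.mul_apply, mul_sub, Finset.sum_sub_distrib]
    rw [← Finset.sum_mul, hrow, one_mul]
    congr 1
    exact Finset.sum_congr rfl fun k _ => by rw [hsymm j k, mul_comm]
  have hstep : ∀ j, ((X * W - α • S) - Matrix.of fun i (_ : Fin n) =>
      (1 / n : ℝ) * ∑ j, (X * W - α • S) i j : Matrix (Fin p) (Fin n) ℝ) i j = W.mulVec u j - α * t j := by
    intro j
    simp only [Matrix.sub_apply, Matrix.of_apply, Matrix.smul_apply, smul_eq_mul,
      Finset.sum_sub_distrib, hsum, hmul, ht, ← Finset.mul_sum]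
    ring
  have hcontr := sum_sq_mulVec_le hherm hrow i₀ hgap hρ u hu0
  calc _ = ∑ j, (W.mulVec u j - α * t j) ^ 2 := Finset.sum_congr rfl fun j _ => by rw [hstep]
    _ ≤ ∑ j, ((1 + ρ ^ 2) / (2 * ρ ^ 2) * W.mulVec u j ^ 2 +
          (1 + ρ ^ 2) / (1 - ρ ^ 2) * (α * t j) ^ 2) :=
        Finset.sum_le_sum fun j _ => sub_sq_le_weighted hρ0 hρ1 _ _
    _ = (1 + ρ ^ 2) / (2 * ρ ^ 2) * ∑ j, W.mulVec u j ^ 2 +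
          α ^ 2 * ((1 + ρ ^ 2) / (1 - ρ ^ 2)) * ∑ j, t j ^ 2 := by
        rw [Finset.sum_add_distrib, Finset.mul_sum, Finset.mul_sum]
        congr 1
        exact Finset.sum_congr rfl fun j _ => by ring
    _ ≤ (1 + ρ ^ 2) / (2 * ρ ^ 2) * (ρ ^ 2 * ∑ j, u j ^ 2) +
          α ^ 2 * ((1 + ρ ^ 2) / (1 - ρ ^ 2)) * ∑ j, t j ^ 2 := by gcongr
    _ = (1 + ρ ^ 2) / 2 * ∑ j, u j ^ 2 +
          α ^ 2 * ((1 + ρ ^ 2) / (1 - ρ ^ 2)) * ∑ j, t j ^ 2 := by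
        field_simp
end

section
/- Let 0 < \mu < L, let A_1,\dots,A_n \in \mathbb{R}^{q\times q} be symmetric with \mu I \preceq A_i \preceq L I, let b_1,\dots,b_n \in \mathbb{R}^q, and let W = (w_{ij}) \in \mathbb{R}^{n\times n} be symmetric, doubly stochastic with nonnegative entries, with eigenvalues 1 = \lambda_1 > \lambda_2 \ge \dots \ge \lambda_n and \rho := max(|\lambda_2|, |\lambda_n|) < 1. Consider the deterministic gradient-tracking iteration: v_{i,k} = A_i x_{i,k} - b_i, s_{i,0} = v_{i,0}, x_{i,k+1} = \sum_j w_{ij} x_{j,k} - \alpha s_{i,k}, s_{i,k+1} = \sum_j w_{ij} s_{j,k} + v_{i,k+1} - v_{i,k}, with arbitrary initial x_{i,0} \in \mathbb{R}^q, and let x^* = (\sum_i A_i)^{-1}(\sum_i b_i). Define the 3\times 3 matrix \tilde{M}(\alpha) with entries \tilde{M}_{11} = 1-\alpha\mu, \tilde{M}_{12} = (2\alpha/\mu + 2\alpha^2)L^2, \tilde{M}_{13} = 0, \tilde{M}_{21} = 0, \tilde{M}_{22} = (1+\rho^2)/2, \tilde{M}_{23} = \alpha^2(1+\rho^2)/(1-\rho^2),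 \tilde{M}_{31} = \frac{1+\rho^2}{1-\rho^2}\cdot 6\alpha^2 L^2, \tilde{M}_{32} = \frac{1+\rho^2}{1-\rho^2}(12L^2 + 12\alpha^2 L^4), \tilde{M}_{33} = (1+\rho^2)/2 + \frac{1+\rho^2}{1-\rho^2}\cdot 6\rho^2 L^2 \alpha^2. Suppose \alpha > 0 satisfies (1+\alpha\mu/2)(1-\alpha\mu)^2 < 1-\alpha\mu, the spectral radius of \tilde{M}(\alpha) is less than 1 - 2\alpha\mu/3, and \tilde{M}(\alpha) has three distinct positive eigenvalues, so that \tilde{M} = P\,diag(\lambda_1',\lambda_2',\lambda_3')\,P^{-1} with P having unit-norm columns; set C = \|P\|_2 \|P^{-1}\|_2. Then for all k \ge 0, with X_k = (x_{1,k},\dots,x_{n,k}) and \bar{x}_k = (1/n)X_k\mathbf{1}_n, S_k = (s_{1,k},\dots,s_{n,k}): max\big( (1/n)\|X_k - x^*\mathbf{1}_n^T\|_F^2, (1/n)\|X_k - \bar{x}_k\mathbf{1}_n^T\|_F^2 \big) \le 3C(1 - 2\alpha\mu/3)^k \big( \|\bar{x}_0 - x^*\|^2 + (\|X_0\|_F^2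 + \|S_0\|_F^2)/n \big). -/
/-- The spectral (operator 2-) norm of a real matrix. -/
noncomputable def specNorm {m n : ℕ} (A : Matrix (Fin m) (Fin n) ℝ) : ℝ :=
  ‖LinearMap.toContinuousLinearMap (Matrix.toEuclideanLin A)‖

/-- Squared Euclidean norm of a real vector. -/
noncomputable def sqVec {q : ℕ} (v : Fin q → ℝ) : ℝ :=
  ∑ a, v a ^ 2

open Matrix

section PowerBound
open scoped Matrix.Norms.L2Operator

theorem one_le_specNorm_mul_specNorm_inv {m : ℕ} [NeZero m] (P : Matrix (Fin m) (Fin m) ℝ)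
    (hP : IsUnit P) : 1 ≤ specNorm P * specNorm P⁻¹ := by
  have hdet : IsUnit P.det := (Matrix.isUnit_iff_isUnit_det P).1 hP
  calc (1 : ℝ) = ‖P * P⁻¹‖ := by
        rw [Matrix.mul_nonsing_inv P hdet, ← Matrix.diagonal_one, Matrix.l2_opNorm_diagonal]
        exact norm_one.symm
    _ ≤ specNorm P * specNorm P⁻¹ := Matrix.l2_opNorm_mul _ _

theorem abs_apply_le_l2_opNorm {m : ℕ} (N : Matrix (Fin m) (Fin m) ℝ) (i j : Fin m) :
    |N i j| ≤ ‖N‖ := by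
  have h := Matrix.l2_opNorm_mulVec N (PiLp.single 2 j (1 : ℝ))
  rw [PiLp.norm_single, norm_one, mul_one] at h
  refine le_trans ?_ h
  have h' := PiLp.norm_apply_le (WithLp.toLp 2 (N *ᵥ (PiLp.single 2 j (1 : ℝ)).ofLp)) i
  simpa using h'

theorem sub_smul_one_eq_conj {m : ℕ} (P : Matrix (Fin m) (Fin m) ℝ) (hP : IsUnit P)
    (lam : Fin m → ℝ) (t : ℝ) :
    P * diagonal lam * P⁻¹ - t • (1 : Matrix (Fin m) (Fin m) ℝ) =
      P * diagonal (fun i => lam i - t) * P⁻¹ := by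
  have hdet : IsUnit P.det := (Matrix.isUnit_iff_isUnit_det P).1 hP
  have h : diagonal (fun i => lam i - t) =
      diagonal lam - t • (1 : Matrix (Fin m) (Fin m) ℝ) := by
    rw [Matrix.smul_one_eq_diagonal, Matrix.diagonal_sub]
  rw [h, Matrix.mul_sub, Matrix.sub_mul, Matrix.mul_smul, Matrix.mul_one, Matrix.smul_mul,
    Matrix.mul_nonsing_inv P hdet]

/-- Entries of a shifted diagonalizable matrix are controlled by the conditioning of the
eigenbasis and the spread of the shifted eigenvalues. -/
theorem abs_apply_le_of_diagonalization {m : ℕ} (P : Matrix (Fin m) (Fin m) ℝ) (hP : IsUnit P)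
    (lam : Fin m → ℝ) (t : ℝ) {R : ℝ} (hR : 0 ≤ R) (h : ∀ i, |lam i - t| ≤ R) (i j : Fin m) :
    |(P * diagonal lam * P⁻¹ - t • (1 : Matrix (Fin m) (Fin m) ℝ)) i j| ≤
      specNorm P * specNorm P⁻¹ * R := by
  have hD : ‖diagonal (fun i => lam i - t)‖ ≤ R := by
    rw [Matrix.l2_opNorm_diagonal]
    exact (pi_norm_le_iff_of_nonneg hR).2 h
  refine (abs_apply_le_l2_opNorm _ i j).trans ?_
  rw [sub_smul_one_eq_conj P hP]
  calc ‖P * diagonal (fun i => lam i - t) * P⁻¹‖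
      ≤ ‖P‖ * ‖diagonal (fun i => lam i - t)‖ * ‖P⁻¹‖ :=
        (Matrix.l2_opNorm_mul _ _).trans
          (mul_le_mul_of_nonneg_right (Matrix.l2_opNorm_mul _ _) (norm_nonneg _))
    _ ≤ ‖P‖ * R * ‖P⁻¹‖ := by gcongr
    _ = specNorm P * specNorm P⁻¹ * R := by
        change _ = ‖P‖ * ‖P⁻¹‖ * R
        ring

end PowerBound

theorem det_smul_one_sub_pos {m : ℕ} (P : Matrix (Fin m) (Fin m) ℝ) (hP : IsUnit P)
    (lam : Fin m → ℝ) (t : ℝ) (h : ∀ i, lam i < t) :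
    0 < (t • (1 : Matrix (Fin m) (Fin m) ℝ) - P * diagonal lam * P⁻¹).det := by
  have hdet : IsUnit P.det := (Matrix.isUnit_iff_isUnit_det P).1 hP
  have h1 : t • (1 : Matrix (Fin m) (Fin m) ℝ) - P * diagonal lam * P⁻¹ =
      P * diagonal (fun i => t - lam i) * P⁻¹ := by
    rw [← neg_sub, sub_smul_one_eq_conj P hP, ← Matrix.neg_mul, ← Matrix.mul_neg,
      Matrix.diagonal_neg]
    simp
  rw [h1, Matrix.det_mul, Matrix.det_mul, mul_right_comm, ← Matrix.det_mul,
    Matrix.mul_nonsing_inv P hdet, Matrix.det_one, one_mul, Matrix.det_diagonal]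
  exact Finset.prod_pos fun i _ => sub_pos.2 (h i)

theorem sq_add_le_young {c : ℝ} (hc : 0 < c) (a b : ℝ) :
    (a + b) ^ 2 ≤ (1 + c) * a ^ 2 + (1 + 1 / c) * b ^ 2 := by
  have h : (1 + c) * a ^ 2 + (1 + 1 / c) * b ^ 2 - (a + b) ^ 2 = (c * a - b) ^ 2 / c := by
    field_simp
    ring
  have : 0 ≤ (c * a - b) ^ 2 / c := by positivity
  linarith

theorem sum_sq_add_le_young {ι : Type*} [Fintype ι] {c : ℝ} (hc : 0 < c) (f g : ι → ℝ) :
    ∑ i, (f i + g i) ^ 2 ≤ (1 + c) * ∑ i, f i ^ 2 + (1 + 1 / c) * ∑ i, g i ^ 2 := by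
  rw [Finset.mul_sum, Finset.mul_sum, ← Finset.sum_add_distrib]
  exact Finset.sum_le_sum fun i _ => sq_add_le_young hc _ _

/-- Squared deviation of a finite family from its mean. -/
noncomputable def sqDev {n : ℕ} (f : Fin n → ℝ) : ℝ :=
  ∑ i, (f i - (1 / n : ℝ) * ∑ j, f j) ^ 2

theorem sqDev_nonneg {n : ℕ} (f : Fin n → ℝ) : 0 ≤ sqDev f :=
  Finset.sum_nonneg fun _ _ => sq_nonneg _

theorem sum_sub_mean {n : ℕ} (hn : 0 < n) (f : Fin n → ℝ) :
    ∑ i, (f i - (1 / n : ℝ) * ∑ j, f j) = 0 := by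
  have : (n : ℝ) ≠ 0 := by positivity
  simp only [Finset.sum_sub_distrib, Finset.sum_const, Finset.card_univ, Fintype.card_fin,
    nsmul_eq_mul]
  field_simp
  ring

theorem sum_sq_sub_eq {n : ℕ} (hn : 0 < n) (f : Fin n → ℝ) (c : ℝ) :
    ∑ i, (f i - c) ^ 2 = sqDev f + n * ((1 / n : ℝ) * (∑ j, f j) - c) ^ 2 := by
  have h := sum_sub_mean hn f
  unfold sqDev
  set m := (1 / n : ℝ) * ∑ j, f j
  have : ∀ i, (f i - c) ^ 2 = (f i - m) ^ 2 + 2 * (m - c) * (f i - m) + (m - c) ^ 2 := by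
    intro i; ring
  simp only [this, Finset.sum_add_distrib, ← Finset.mul_sum, h, Finset.sum_const,
    Finset.card_univ, Fintype.card_fin, nsmul_eq_mul]
  ring

theorem sqDev_le_sum_sq {n : ℕ} (hn : 0 < n) (f : Fin n → ℝ) : sqDev f ≤ ∑ i, f i ^ 2 := by
  have h := sum_sq_sub_eq hn f 0
  simp only [sub_zero] at h
  rw [h]
  exact le_add_of_nonneg_right (by positivity)

theorem sq_mean_le {n : ℕ} (hn : 0 < n) (f : Fin n → ℝ) :
    ((1 / n : ℝ) * ∑ i, f i) ^ 2 ≤ (1 / n : ℝ) * ∑ i, f i ^ 2 := by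
  have h := sum_sq_sub_eq hn f 0
  simp only [sub_zero] at h
  have hn' : (0 : ℝ) < n := by exact_mod_cast hn
  rw [h, mul_add, ← mul_assoc, one_div_mul_cancel hn'.ne', one_mul]
  exact le_add_of_nonneg_left (mul_nonneg (by positivity) (sqDev_nonneg f))

theorem sqDev_const_mul {n : ℕ} (c : ℝ) (f : Fin n → ℝ) :
    sqDev (fun i => c * f i) = c ^ 2 * sqDev f := by
  have h : ∀ i, (c * f i - (1 / n : ℝ) * ∑ j, c * f j) ^ 2 =
      c ^ 2 * (f i - (1 / n : ℝ) * ∑ j, f j) ^ 2 := fun i => by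
    rw [← Finset.mul_sum]
    ring
  unfold sqDev
  rw [Finset.sum_congr rfl fun i _ => h i, ← Finset.mul_sum]

/-- A symmetric `B` with `0 ≤ B ≤ L` satisfies `B² ≤ L B`. -/
theorem sqVec_mulVec_le {q : ℕ} (B : Matrix (Fin q) (Fin q) ℝ) (hB : B.IsSymm) {L : ℝ}
    (hL : 0 < L) (hlow : B.PosSemidef)
    (hupp : (L • (1 : Matrix (Fin q) (Fin q) ℝ) - B).PosSemidef) (v : Fin q → ℝ) :
    sqVec (B *ᵥ v) ≤ L * (v ⬝ᵥ B *ᵥ v) := by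
  have h1 := hlow.dotProduct_mulVec_nonneg (L • v - B *ᵥ v)
  have h2 := hupp.dotProduct_mulVec_nonneg (B *ᵥ v)
  have hsq : ∀ w : Fin q → ℝ, sqVec w = w ⬝ᵥ w := fun w => by
    simp [sqVec, dotProduct, sq]
  have hBv : ∀ w z : Fin q → ℝ, w ⬝ᵥ B *ᵥ z = B *ᵥ w ⬝ᵥ z := fun w z => by
    rw [Matrix.dotProduct_mulVec, ← Matrix.mulVec_transpose, hB.eq]
  have key : L * (L * (v ⬝ᵥ B *ᵥ v) - sqVec (B *ᵥ v)) =
      (L • v - B *ᵥ v) ⬝ᵥ B *ᵥ (L • v - B *ᵥ v) +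
      (B *ᵥ v) ⬝ᵥ (L • (1 : Matrix (Fin q) (Fin q) ℝ) - B) *ᵥ (B *ᵥ v) := by
    rw [hsq]
    simp only [sub_mulVec, mulVec_sub, smul_mulVec, one_mulVec,
      mulVec_smul, dotProduct_sub, sub_dotProduct,
      smul_dotProduct, dotProduct_smul, smul_eq_mul, hBv]
    ring
  simp only [star_trivial] at h1 h2
  have : 0 ≤ L * (L * (v ⬝ᵥ B *ᵥ v) - sqVec (B *ᵥ v)) := key ▸ add_nonneg h1 h2
  have := nonneg_of_mul_nonneg_right this hL
  linarith

theorem sum_sq_mulVec_le_of_sum_eq_zero {n : ℕ} (W : Matrix (Fin n) (Fin n) ℝ)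
    (hWrow : ∀ i, ∑ j, W i j = 1) (hherm : W.IsHermitian) (i₀ : Fin n)
    (hgap : ∀ i, i ≠ i₀ → hherm.eigenvalues i < 1) (ρ : ℝ)
    (hρ : ∀ i, i ≠ i₀ → |hherm.eigenvalues i| ≤ ρ) (f : Fin n → ℝ) (hf : ∑ i, f i = 0) :
    ∑ i, (W *ᵥ f) i ^ 2 ≤ ρ ^ 2 * ∑ i, f i ^ 2 := by
  let e := hherm.eigenvectorBasis
  have hW : ∀ (g : Fin n → ℝ) i, inner ℝ (e i) (WithLp.toLp 2 (W *ᵥ g)) =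
      hherm.eigenvalues i * inner ℝ (e i) (WithLp.toLp 2 g) := by
    intro g i
    have h := hherm.mulVec_eigenvectorBasis i
    have hs : Wᵀ = W := by simpa using hherm.eq
    simp only [EuclideanSpace.inner_eq_star_dotProduct, star_trivial]
    rw [dotProduct_comm, Matrix.dotProduct_mulVec, ← Matrix.mulVec_transpose, hs, h,
      smul_dotProduct, smul_eq_mul, dotProduct_comm]
  have hsq : ∀ g : Fin n → ℝ, ∑ i, g i ^ 2 = ∑ i, inner ℝ (e i) (WithLp.toLp 2 g) ^ 2 := by
    intro g
    have h := e.sum_sq_norm_inner_right (WithLp.toLp 2 g)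
    simp only [Real.norm_eq_abs, sq_abs, EuclideanSpace.norm_sq_eq] at h
    exact h.symm
  have hone : W *ᵥ (fun _ => 1) = fun _ => 1 := by
    ext i
    simp [mulVec, dotProduct, hWrow]
  let o : EuclideanSpace ℝ (Fin n) := WithLp.toLp 2 fun _ => 1
  have hperp : ∀ i, i ≠ i₀ → inner ℝ (e i) o = 0 := by
    intro i hi
    have h := hW (fun _ => 1) i
    rw [hone] at h
    have h' : (1 - hherm.eigenvalues i) * inner ℝ (e i) o = 0 := by
      change inner ℝ (e i) o = _ * inner ℝ (e i) o at h
      linarith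
    exact (mul_eq_zero.1 h').resolve_left (by linarith [hgap i hi])
  have ho : o = (inner ℝ (e i₀) o : ℝ) • e i₀ := by
    conv_lhs => rw [← e.sum_repr' o]
    exact Finset.sum_eq_single i₀ (fun i _ hi => by rw [hperp i hi, zero_smul]) (by simp)
  have hof : inner ℝ o (WithLp.toLp 2 f) = (0 : ℝ) := by
    simp [o, EuclideanSpace.inner_eq_star_dotProduct, dotProduct, hf]
  have hne : (inner ℝ (e i₀) o : ℝ) ≠ 0 := by
    intro h
    rw [h, zero_smul] at ho
    have := congrArg (fun v : EuclideanSpace ℝ (Fin n) => v i₀) ho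
    simp [o] at this
  have hfi : inner ℝ (e i₀) (WithLp.toLp 2 f) = (0 : ℝ) := by
    rw [ho, real_inner_smul_left] at hof
    exact (mul_eq_zero.1 hof).resolve_left hne
  rw [hsq, hsq f, Finset.mul_sum]
  refine Finset.sum_le_sum fun i _ => ?_
  rw [hW, mul_pow]
  by_cases hi : i = i₀
  · rw [hi, hfi]; simp
  · exact mul_le_mul_of_nonneg_right
      (sq_le_sq' (abs_le.1 (hρ i hi)).1 (abs_le.1 (hρ i hi)).2) (sq_nonneg _)

section Columns

variable {n : ℕ} (W : Matrix (Fin n) (Fin n) ℝ)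

theorem mulVec_sub_const (hWrow : ∀ i, ∑ j, W i j = 1) (f : Fin n → ℝ) (c : ℝ) (i : Fin n) :
    (W *ᵥ fun j => f j - c) i = (W *ᵥ f) i - c := by
  simp only [mulVec, dotProduct, mul_sub, Finset.sum_sub_distrib, ← Finset.sum_mul, hWrow, one_mul]

theorem sum_mulVec_of_col_sum (hWcol : ∀ j, ∑ i, W i j = 1) (f : Fin n → ℝ) :
    ∑ i, (W *ᵥ f) i = ∑ i, f i := by
  simp only [mulVec, dotProduct]
  rw [Finset.sum_comm]
  simp only [← Finset.sum_mul, hWcol, one_mul]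

theorem sqDev_mulVec_add_le (hn : 0 < n) (hWrow : ∀ i, ∑ j, W i j = 1)
    (hWcol : ∀ j, ∑ i, W i j = 1) {ρ : ℝ}
    (hW : ∀ f : Fin n → ℝ, ∑ i, f i = 0 → ∑ i, (W *ᵥ f) i ^ 2 ≤ ρ ^ 2 * ∑ i, f i ^ 2)
    {c : ℝ} (hc : 0 < c) (f h : Fin n → ℝ) :
    sqDev (fun i => (W *ᵥ f) i + h i) ≤
      (1 + c) * (ρ ^ 2 * sqDev f) + (1 + 1 / c) * sqDev h := by
  have h1 : ∀ i, (W *ᵥ f) i + h i - (1 / n : ℝ) * ∑ j, ((W *ᵥ f) j + h j) =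
      (W *ᵥ fun j => f j - (1 / n : ℝ) * ∑ l, f l) i + (h i - (1 / n : ℝ) * ∑ j, h j) := by
    intro i
    rw [mulVec_sub_const W hWrow, Finset.sum_add_distrib, sum_mulVec_of_col_sum W hWcol]
    ring
  have h2 := hW _ (sum_sub_mean hn f)
  unfold sqDev
  rw [Finset.sum_congr rfl fun i _ => congrArg (· ^ 2) (h1 i)]
  refine (sum_sq_add_le_young hc _ _).trans ?_
  gcongr

theorem sum_sq_increment_le (hn : 0 < n) (hWrow : ∀ i, ∑ j, W i j = 1)
    (hWcol : ∀ j, ∑ i, W i j = 1) {ρ : ℝ} (hρ : ρ ^ 2 ≤ 1)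
    (hW : ∀ f : Fin n → ℝ, ∑ i, f i = 0 → ∑ i, (W *ᵥ f) i ^ 2 ≤ ρ ^ 2 * ∑ i, f i ^ 2)
    (α : ℝ) (f g : Fin n → ℝ) :
    ∑ i, ((W *ᵥ f) i - α * g i - f i) ^ 2 ≤
      6 * sqDev f + 3 * α ^ 2 * sqDev g + n * (α ^ 2 * ((1 / n : ℝ) * ∑ i, g i) ^ 2) := by
  have hn' : (n : ℝ) ≠ 0 := by positivity
  set F : Fin n → ℝ := fun i => f i - (1 / n : ℝ) * ∑ j, f j with hF
  set H : Fin n → ℝ := fun i => g i - (1 / n : ℝ) * ∑ j, g j with hH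
  have hmean : (1 / n : ℝ) * ∑ i, ((W *ᵥ f) i - α * g i - f i) =
      -(α * ((1 / n : ℝ) * ∑ i, g i)) := by
    simp only [Finset.sum_sub_distrib, ← Finset.mul_sum, sum_mulVec_of_col_sum W hWcol]
    ring
  have h0 := sum_sq_sub_eq hn (fun i => (W *ᵥ f) i - α * g i - f i) 0
  simp only [sub_zero] at h0
  rw [h0, hmean]
  have h1 : sqDev (fun i => (W *ᵥ f) i - α * g i - f i) =
      ∑ i, (((W *ᵥ F) i + -F i) + -α * H i) ^ 2 := by
    unfold sqDev
    refine Finset.sum_congr rfl fun i _ => ?_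
    rw [hmean, hF, mulVec_sub_const W hWrow]
    simp only [hH]
    ring
  have h2 := sum_sq_add_le_young (c := 1 / 2) (by norm_num)
    (fun i => (W *ᵥ F) i + -F i) (fun i => -α * H i)
  have h3 := sum_sq_add_le_young (c := 1) one_pos (fun i => (W *ᵥ F) i) (fun i => -F i)
  have h4 := hW F (sum_sub_mean hn f)
  have h5 : ∑ i, (-α * H i) ^ 2 = α ^ 2 * sqDev g := by
    simp only [mul_pow, neg_sq, ← Finset.mul_sum]
    rfl
  have h6 : ∑ i, (-F i) ^ 2 = sqDev f := by
    simp only [neg_sq]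
    rfl
  have h7 : ∑ i, F i ^ 2 = sqDev f := rfl
  rw [h5] at h2
  rw [h6] at h3
  rw [h7] at h4
  have h8 : ρ ^ 2 * sqDev f ≤ 1 * sqDev f := mul_le_mul_of_nonneg_right hρ (sqDev_nonneg f)
  rw [h1]
  linarith

end Columns

section Step

variable {n q : ℕ} {μ L : ℝ} {A : Fin n → Matrix (Fin q) (Fin q) ℝ}

/-- Effect of a step on the distance of the mean iterate to the minimizer. -/
theorem sqVec_mean_step_le (hn : 0 < n) (hL : 0 < L) (hAsymm : ∀ i, (A i).IsSymm)
    (hApos : ∀ i, (A i).PosSemidef)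
    (hAlow : ∀ i, (A i - μ • (1 : Matrix (Fin q) (Fin q) ℝ)).PosSemidef)
    (hAupp : ∀ i, (L • (1 : Matrix (Fin q) (Fin q) ℝ) - A i).PosSemidef)
    {α : ℝ} (hα : 0 < α) (x : Fin n → Fin q → ℝ) (y w sb : Fin q → ℝ)
    (hw : ∀ a, w a = (1 / n : ℝ) * (∑ i, x i a) - y a)
    (hsb : ∀ a, sb a = (1 / n : ℝ) * ∑ i, (A i *ᵥ (x i - y)) a) :
    n * sqVec sb ≤ L * ∑ i, (x i - y) ⬝ᵥ A i *ᵥ (x i - y) ∧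
    n * sqVec (w - α • sb) ≤ (1 - α * μ) * (n * sqVec w) + α * L * ∑ a, sqDev (fun i => x i a)
      - α * (1 - α * L) * ∑ i, (x i - y) ⬝ᵥ A i *ᵥ (x i - y) := by
  have hn' : (0 : ℝ) < n := by exact_mod_cast hn
  have hsq : ∀ w : Fin q → ℝ, sqVec w = w ⬝ᵥ w := fun w => by
    simp [sqVec, dotProduct, sq]
  set G := ∑ i, (x i - y) ⬝ᵥ A i *ᵥ (x i - y) with hG
  have h1 : n * sqVec sb ≤ L * G := by
    have h : ∀ a, n * sb a ^ 2 ≤ ∑ i, (A i *ᵥ (x i - y)) a ^ 2 := fun a => by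
      have := mul_le_mul_of_nonneg_left (sq_mean_le hn fun i => (A i *ᵥ (x i - y)) a) hn'.le
      rw [← mul_assoc, mul_one_div_cancel hn'.ne', one_mul] at this
      rwa [hsb]
    calc n * sqVec sb = ∑ a, n * sb a ^ 2 := Finset.mul_sum _ _ _
      _ ≤ ∑ a, ∑ i, (A i *ᵥ (x i - y)) a ^ 2 := Finset.sum_le_sum fun a _ => h a
      _ = ∑ i, sqVec (A i *ᵥ (x i - y)) := Finset.sum_comm
      _ ≤ ∑ i, L * ((x i - y) ⬝ᵥ A i *ᵥ (x i - y)) := Finset.sum_le_sum fun i _ =>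
          sqVec_mulVec_le _ (hAsymm i) hL (hApos i) (hAupp i) _
      _ = L * G := (Finset.mul_sum _ _ _).symm
  refine ⟨h1, ?_⟩
  have h2 : ∀ i, (x i - y) ⬝ᵥ A i *ᵥ (x i - y) + μ * sqVec w - L * sqVec (x i - y - w) ≤
      2 * (w ⬝ᵥ A i *ᵥ (x i - y)) := by
    intro i
    set z := x i - y
    have hBv : w ⬝ᵥ A i *ᵥ z = z ⬝ᵥ A i *ᵥ w := by
      rw [Matrix.dotProduct_mulVec, ← Matrix.mulVec_transpose, (hAsymm i).eq, dotProduct_comm]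
    have hl := (hAlow i).dotProduct_mulVec_nonneg w
    have hu := (hAupp i).dotProduct_mulVec_nonneg (z - w)
    simp only [star_trivial, sub_mulVec, mulVec_sub, smul_mulVec, one_mulVec, dotProduct_sub,
      sub_dotProduct, dotProduct_smul, smul_eq_mul] at hl hu
    rw [hsq, hsq]
    simp only [dotProduct_sub, sub_dotProduct]
    linarith
  have h3 : n * (w ⬝ᵥ sb) = ∑ i, w ⬝ᵥ A i *ᵥ (x i - y) := by
    simp only [dotProduct, hsb]
    rw [Finset.sum_comm, Finset.mul_sum]
    refine Finset.sum_congr rfl fun a _ => ?_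
    rw [← Finset.mul_sum]
    field_simp
  have h4 : ∑ i, sqVec (x i - y - w) = ∑ a, sqDev fun i => x i a := by
    unfold sqVec sqDev
    rw [Finset.sum_comm]
    refine Finset.sum_congr rfl fun a _ => Finset.sum_congr rfl fun i _ => ?_
    simp only [Pi.sub_apply, hw]
    ring
  have h5 : G + n * (μ * sqVec w) - L * ∑ a, sqDev (fun i => x i a) ≤ 2 * (n * (w ⬝ᵥ sb)) := by
    have := Finset.sum_le_sum fun i (_ : i ∈ Finset.univ) => h2 i
    simpa only [Finset.sum_sub_distrib, Finset.sum_add_distrib, ← Finset.mul_sum, h4, ← h3, ← hG,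
      Finset.sum_const, Finset.card_univ, Fintype.card_fin, nsmul_eq_mul, mul_left_comm μ] using this
  have h6 : sqVec (w - α • sb) = sqVec w - 2 * α * (w ⬝ᵥ sb) + α ^ 2 * sqVec sb := by
    simp only [hsq, sub_dotProduct, dotProduct_sub, smul_dotProduct, dotProduct_smul, smul_eq_mul,
      dotProduct_comm sb w]
    ring
  rw [h6]
  have h7 := mul_le_mul_of_nonneg_left h5 hα.le
  have h8 := mul_le_mul_of_nonneg_left h1 (sq_nonneg α)
  linarith

theorem sum_sqDev_step_le (hn : 0 < n) (W : Matrix (Fin n) (Fin n) ℝ)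
    (hWrow : ∀ i, ∑ j, W i j = 1) (hWcol : ∀ j, ∑ i, W i j = 1) {ρ : ℝ} (hρ0 : 0 < ρ)
    (hρ1 : ρ < 1)
    (hW : ∀ f : Fin n → ℝ, ∑ i, f i = 0 → ∑ i, (W *ᵥ f) i ^ 2 ≤ ρ ^ 2 * ∑ i, f i ^ 2)
    (x x' h : Fin n → Fin q → ℝ)
    (hx : ∀ i a, x' i a = (W *ᵥ fun j => x j a) i + h i a) :
    ∑ a, sqDev (fun i => x' i a) ≤ (1 + ρ ^ 2) / 2 * ∑ a, sqDev (fun i => x i a) +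
      (1 + ρ ^ 2) / (1 - ρ ^ 2) * ∑ a, sqDev (fun i => h i a) := by
  have hr : 0 < 1 - ρ ^ 2 := by nlinarith
  rw [Finset.mul_sum, Finset.mul_sum, ← Finset.sum_add_distrib]
  refine Finset.sum_le_sum fun a _ => ?_
  simp only [hx]
  refine (sqDev_mulVec_add_le W hn hWrow hWcol hW (c := (1 - ρ ^ 2) / (2 * ρ ^ 2))
    (by positivity) _ _).trans_eq ?_
  have : (1 - ρ ^ 2) ≠ 0 := hr.ne'
  field_simp
  ring

theorem sum_sq_gradient_increment_le (hn : 0 < n) (hL : 0 < L) (hAsymm : ∀ i, (A i).IsSymm)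
    (hApos : ∀ i, (A i).PosSemidef)
    (hAupp : ∀ i, (L • (1 : Matrix (Fin q) (Fin q) ℝ) - A i).PosSemidef)
    (W : Matrix (Fin n) (Fin n) ℝ)
    (hWrow : ∀ i, ∑ j, W i j = 1) (hWcol : ∀ j, ∑ i, W i j = 1) {ρ : ℝ} (hρ : ρ ^ 2 ≤ 1)
    (hW : ∀ f : Fin n → ℝ, ∑ i, f i = 0 → ∑ i, (W *ᵥ f) i ^ 2 ≤ ρ ^ 2 * ∑ i, f i ^ 2)
    (α : ℝ) (x s x' : Fin n → Fin q → ℝ) (sb : Fin q → ℝ)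
    (hsb : ∀ a, sb a = (1 / n : ℝ) * ∑ i, s i a)
    (hx : ∀ i a, x' i a = (W *ᵥ fun j => x j a) i - α * s i a) :
    ∑ a, sqDev (fun i => (A i *ᵥ (x' i - x i)) a) ≤
      L ^ 2 * (6 * ∑ a, sqDev (fun i => x i a) + 3 * α ^ 2 * ∑ a, sqDev (fun i => s i a) +
        α ^ 2 * (n * sqVec sb)) := by
  have hbound : ∀ i (v : Fin q → ℝ), sqVec (A i *ᵥ v) ≤ L ^ 2 * sqVec v := fun i v => by
    have h1 := sqVec_mulVec_le _ (hAsymm i) hL (hApos i) (hAupp i) v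
    have h2 := (hAupp i).dotProduct_mulVec_nonneg v
    have hsq : sqVec v = v ⬝ᵥ v := by simp [sqVec, dotProduct, sq]
    simp only [star_trivial, sub_mulVec, smul_mulVec, one_mulVec, dotProduct_sub,
      dotProduct_smul, smul_eq_mul] at h2
    rw [hsq]
    nlinarith
  calc ∑ a, sqDev (fun i => (A i *ᵥ (x' i - x i)) a)
      ≤ ∑ a, ∑ i, (A i *ᵥ (x' i - x i)) a ^ 2 :=
        Finset.sum_le_sum fun a _ => sqDev_le_sum_sq hn _
    _ = ∑ i, sqVec (A i *ᵥ (x' i - x i)) := Finset.sum_comm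
    _ ≤ ∑ i, L ^ 2 * sqVec (x' i - x i) := Finset.sum_le_sum fun i _ => hbound i _
    _ = L ^ 2 * ∑ a, ∑ i, ((W *ᵥ fun j => x j a) i - α * s i a - x i a) ^ 2 := by
        rw [← Finset.mul_sum, Finset.sum_comm]
        simp only [sqVec, Pi.sub_apply, hx]
    _ ≤ _ := by
        refine mul_le_mul_of_nonneg_left ?_ (sq_nonneg L)
        simp only [sqVec, Finset.mul_sum, ← Finset.sum_add_distrib]
        refine Finset.sum_le_sum fun a _ => ?_
        have := sum_sq_increment_le W hn hWrow hWcol hρ hW α (fun i => x i a) (fun i => s i a)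
        rw [← hsb] at this
        linarith

end Step

/-- Consequences of the spectral condition on the comparison matrix: a small-gain bound on the step
size and a lower bound on the conditioning of the eigenbasis. -/
theorem small_gain_of_spectrum_lt {μ L ρ α : ℝ} (hμ : 0 < μ) (hμL : μ < L) (hρ0 : 0 < ρ)
    (hρ1 : ρ < 1) (hα : 0 < α) (P : Matrix (Fin 3) (Fin 3) ℝ) (hP : IsUnit P) (lam : Fin 3 → ℝ)
    (hdiag : !![1 - α * μ, (2 * α / μ + 2 * α ^ 2) * L ^ 2, 0;
         0, (1 + ρ ^ 2) / 2, α ^ 2 * (1 + ρ ^ 2) / (1 - ρ ^ 2);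
         (1 + ρ ^ 2) / (1 - ρ ^ 2) * (6 * α ^ 2 * L ^ 2),
         (1 + ρ ^ 2) / (1 - ρ ^ 2) * (12 * L ^ 2 + 12 * α ^ 2 * L ^ 4),
         (1 + ρ ^ 2) / 2 + (1 + ρ ^ 2) / (1 - ρ ^ 2) * (6 * ρ ^ 2 * L ^ 2) * α ^ 2] =
      P * diagonal lam * P⁻¹)
    (hspec : ∀ i, lam i < 1 - 2 * α * μ / 3) {κ η : ℝ} (hκ : κ = (1 + ρ ^ 2) / (1 - ρ ^ 2))
    (hη : η = 1 - 2 * α * μ / 3 - (1 + ρ ^ 2) / 2) :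
    1 ≤ κ ∧ 0 < η ∧ η ≤ 1 / 2 ∧ 12 * κ ^ 2 * (α * L) ^ 2 ≤ η ^ 2 ∧ α * L ≤ 3 / 10 * η ∧
      κ * α ^ 2 ≤ specNorm P * specNorm P⁻¹ * (11 / 10 * η) := by
  have hL : 0 < L := hμ.trans hμL
  have hr : 0 < 1 - ρ ^ 2 := by nlinarith
  have hαμ : 0 < α * μ := mul_pos hα hμ
  have hκ1 : 1 ≤ κ := by
    rw [hκ, le_div_iff₀ hr]
    nlinarith [sq_nonneg ρ]
  have hκ0 : 0 < κ := one_pos.trans_le hκ1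
  have hq : α ^ 2 * (1 + ρ ^ 2) / (1 - ρ ^ 2) = κ * α ^ 2 := by
    rw [hκ]
    ring
  rw [hq, ← hκ] at hdiag
  have hdet : ∀ t, 1 - 2 * α * μ / 3 ≤ t →
      0 < (t - (1 - α * μ)) * ((t - (1 + ρ ^ 2) / 2) *
          (t - ((1 + ρ ^ 2) / 2 + κ * (6 * ρ ^ 2 * L ^ 2) * α ^ 2)) -
          κ * α ^ 2 * (κ * (12 * L ^ 2 + 12 * α ^ 2 * L ^ 4))) -
        (2 * α / μ + 2 * α ^ 2) * L ^ 2 * (κ * α ^ 2) * (κ * (6 * α ^ 2 * L ^ 2)) := by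
    intro t ht
    have h := det_smul_one_sub_pos P hP lam t fun i => (hspec i).trans_le ht
    rw [← hdiag, Matrix.det_fin_three] at h
    simp only [Matrix.sub_apply, Matrix.smul_apply, Matrix.one_apply, Matrix.of_apply,
      Matrix.cons_val', Matrix.cons_val_zero, Matrix.cons_val_one, Matrix.cons_val,
      Fin.isValue, smul_eq_mul, Fin.reduceEq, if_true, if_false, mul_one, mul_zero] at h
    linarith
  have hpqu : 0 ≤ (2 * α / μ + 2 * α ^ 2) * L ^ 2 * (κ * α ^ 2) * (κ * (6 * α ^ 2 * L ^ 2)) := by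
    positivity
  have hqv : 0 ≤ κ * α ^ 2 * (κ * (12 * L ^ 2 + 12 * α ^ 2 * L ^ 4)) := by positivity
  have hη0 : 0 < η := by
    by_contra hneg
    have h := hdet ((1 + ρ ^ 2) / 2) (by linarith)
    rw [sub_self, zero_mul, zero_sub] at h
    have : 0 ≤ (1 + ρ ^ 2) / 2 - (1 - α * μ) := by linarith
    nlinarith [mul_nonneg this hqv]
  have hgain : 12 * κ ^ 2 * (α * L) ^ 2 ≤ η ^ 2 := by
    have h := hdet _ le_rfl
    rw [← hη] at h
    have ha : 0 < 1 - 2 * α * μ / 3 - (1 - α * μ) := by linarith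
    have h' := pos_of_mul_pos_right (lt_of_lt_of_le h (sub_le_self _ hpqu)) ha.le
    have h1 : 0 ≤ η * (κ * (6 * ρ ^ 2 * L ^ 2) * α ^ 2) := by positivity
    have h2 : 0 ≤ κ ^ 2 * (12 * (α ^ 2 * L ^ 2) ^ 2) := by positivity
    nlinarith
  have hαL : α * L ≤ 3 / 10 * η := by
    have h1 : (α * L) ^ 2 ≤ κ ^ 2 * (α * L) ^ 2 :=
      le_mul_of_one_le_left (sq_nonneg _) (one_le_pow₀ hκ1)
    refine abs_le_of_sq_le_sq' ?_ (by positivity) |>.2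
    nlinarith
  have hαμL : α * μ ≤ α * L := mul_le_mul_of_nonneg_left hμL.le hα.le
  refine ⟨hκ1, hη0, by nlinarith [sq_nonneg ρ], hgain, hαL, ?_⟩
  have htr : 1 - α * μ + (1 + ρ ^ 2) / 2 +
      ((1 + ρ ^ 2) / 2 + κ * (6 * ρ ^ 2 * L ^ 2) * α ^ 2) = lam 0 + lam 1 + lam 2 := by
    have h := congrArg Matrix.trace hdiag
    rw [Matrix.trace_mul_comm, ← Matrix.mul_assoc,
      Matrix.nonsing_inv_mul P ((Matrix.isUnit_iff_isUnit_det P).1 hP), Matrix.one_mul] at h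
    simpa [Matrix.trace_fin_three, Fin.sum_univ_three] using h
  have hs : 0 ≤ κ * (6 * ρ ^ 2 * L ^ 2) * α ^ 2 := by positivity
  have hdev : ∀ i, |lam i - (1 + ρ ^ 2) / 2| ≤ 11 / 10 * η := by
    have h0 := hspec 0
    have h1 := hspec 1
    have h2 := hspec 2
    intro i
    rw [abs_le]
    fin_cases i <;> constructor <;> simp only [Fin.zero_eta, Fin.mk_one, Fin.reduceFinMk] <;>
      linarith
  have h := abs_apply_le_of_diagonalization P hP lam ((1 + ρ ^ 2) / 2) (by positivity) hdev 1 2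
  rw [← hdiag] at h
  refine (le_abs_self _).trans (le_trans (le_of_eq ?_) h)
  simp

theorem lyapunov_step {μ L α κ η τ X D E G S X' D' E' : ℝ} (hL : 0 < L)
    (hα : 0 < α) (hμ : 0 < μ) (hκ : 1 ≤ κ) (hη0 : 0 < η) (hη1 : η ≤ 1 / 2)
    (hgain : 12 * κ ^ 2 * (α * L) ^ 2 ≤ η ^ 2) (hαL : α * L ≤ 3 / 10 * η)
    (hτ : τ = 1 - 2 * α * μ / 3) (hX : 0 ≤ X) (hD : 0 ≤ D) (hE : 0 ≤ E) (hG : 0 ≤ G)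
    (hS : S ≤ L * G) (hX' : X' ≤ (1 - α * μ) * X + α * L * D - α * (1 - α * L) * G)
    (hD' : D' ≤ (τ - η) * D + κ * (α ^ 2 * E))
    (hE' : E' ≤ (τ - η) * E + κ * (L ^ 2 * (6 * D + 3 * α ^ 2 * E + α ^ 2 * S))) :
    X' + D' + 6 / 5 * (κ * α ^ 2) / η * E' ≤
      τ * (X + D + 6 / 5 * (κ * α ^ 2) / η * E) := by
  have hκ0 : 0 < κ := one_pos.trans_le hκ
  set B := 6 / 5 * (κ * α ^ 2) / η with hB
  have hBη : B * η = 6 / 5 * (κ * α ^ 2) := by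
    rw [hB]
    field_simp
  have hB0 : 0 < B := by positivity
  have hBL : B * (κ * L ^ 2) ≤ η / 10 := by
    have : B * (κ * L ^ 2) * η ≤ η / 10 * η := by
      calc B * (κ * L ^ 2) * η = B * η * (κ * L ^ 2) := by ring
        _ = 1 / 10 * (12 * κ ^ 2 * (α * L) ^ 2) := by rw [hBη]; ring
        _ ≤ η / 10 * η := by nlinarith
    exact le_of_mul_le_mul_right this hη0
  have hκβ : 3 * (κ * (α * L) ^ 2) ≤ η / 6 := by
    have h1 : κ * (α * L) ^ 2 ≤ κ ^ 2 * (α * L) ^ 2 :=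
      mul_le_mul_of_nonneg_right (by nlinarith) (sq_nonneg _)
    nlinarith
  have hd : (α * L + 6 * (B * (κ * L ^ 2))) * D ≤ η * D :=
    mul_le_mul_of_nonneg_right (by linarith) hD
  have he : (κ * α ^ 2 + B * (3 * (κ * (α * L) ^ 2))) * E ≤ B * η * E := by
    refine mul_le_mul_of_nonneg_right ?_ hE
    have := mul_le_mul_of_nonneg_left hκβ hB0.le
    linarith
  have hg : B * (κ * L ^ 2) * (α ^ 2 * (L * G)) ≤ α * (1 - α * L) * G := by
    calc B * (κ * L ^ 2) * (α ^ 2 * (L * G)) ≤ η / 10 * (α ^ 2 * (L * G)) := by gcongr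
      _ = α * (η / 10 * (α * L)) * G := by ring
      _ ≤ α * (1 - α * L) * G := by
        gcongr
        nlinarith [mul_pos hα hL]
  have hs : B * (κ * L ^ 2) * (α ^ 2 * S) ≤ B * (κ * L ^ 2) * (α ^ 2 * (L * G)) := by gcongr
  have hx : (1 - α * μ) * X ≤ τ * X :=
    mul_le_mul_of_nonneg_right (by nlinarith [mul_pos hα hμ]) hX
  have hBE := mul_le_mul_of_nonneg_left hE' hB0.le
  linarith

/-- Linear convergence of deterministic gradient tracking on strongly convex quadratics:
both the distance to `x* = (∑ᵢ Aᵢ)⁻¹(∑ᵢ bᵢ)` and the consensus error decay at rate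
`(1 - 2αμ/3)^k`, with constant `3C`, `C = ‖P‖₂‖P⁻¹‖₂`. -/
theorem stmt_9 (n q : ℕ) (hn : 0 < n) (μ L : ℝ) (hμ : 0 < μ) (hμL : μ < L)
    (A : Fin n → Matrix (Fin q) (Fin q) ℝ) (hAsymm : ∀ i, (A i).IsSymm)
    (hAlow : ∀ i, (A i - μ • (1 : Matrix (Fin q) (Fin q) ℝ)).PosSemidef)
    (hAupp : ∀ i, (L • (1 : Matrix (Fin q) (Fin q) ℝ) - A i).PosSemidef)
    (b : Fin n → Fin q → ℝ)
    (W : Matrix (Fin n) (Fin n) ℝ) (hWnn : ∀ i j, 0 ≤ W i j)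
    (hWrow : ∀ i, ∑ j, W i j = 1) (hWcol : ∀ j, ∑ i, W i j = 1)
    (hherm : W.IsHermitian)
    (i₀ : Fin n) (htop : hherm.eigenvalues i₀ = 1)
    (hgap : ∀ i, i ≠ i₀ → hherm.eigenvalues i < 1)
    (ρ : ℝ) (hρ0 : 0 < ρ) (hρ : ∀ i, i ≠ i₀ → |hherm.eigenvalues i| ≤ ρ) (hρ1 : ρ < 1)
    (α : ℝ) (hα : 0 < α)
    (x s : Fin n → ℕ → Fin q → ℝ)
    (hs0 : ∀ i, s i 0 = (A i).mulVec (x i 0) - b i)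
    (hxrec : ∀ i k, x i (k + 1) = (∑ j, W i j • x j k) - α • s i k)
    (hsrec : ∀ i k, s i (k + 1) = (∑ j, W i j • s j k)
      + ((A i).mulVec (x i (k + 1)) - b i) - ((A i).mulVec (x i k) - b i))
    (xstar : Fin q → ℝ) (hxstar : xstar = (∑ i, A i)⁻¹.mulVec (∑ i, b i))
    (Mt : Matrix (Fin 3) (Fin 3) ℝ)
    (hMt : Mt =
      !![1 - α * μ, (2 * α / μ + 2 * α ^ 2) * L ^ 2, 0;
         0, (1 + ρ ^ 2) / 2, α ^ 2 * (1 + ρ ^ 2) / (1 - ρ ^ 2);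
         (1 + ρ ^ 2) / (1 - ρ ^ 2) * (6 * α ^ 2 * L ^ 2),
         (1 + ρ ^ 2) / (1 - ρ ^ 2) * (12 * L ^ 2 + 12 * α ^ 2 * L ^ 4),
         (1 + ρ ^ 2) / 2 + (1 + ρ ^ 2) / (1 - ρ ^ 2) * (6 * ρ ^ 2 * L ^ 2) * α ^ 2])
    (hcond : (1 + α * μ / 2) * (1 - α * μ) ^ 2 < 1 - α * μ)
    (P : Matrix (Fin 3) (Fin 3) ℝ) (hP : IsUnit P)
    (lam : Fin 3 → ℝ) (hlampos : ∀ i, 0 < lam i) (hlaminj : Function.Injective lam)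
    (hdiag : Mt = P * Matrix.diagonal lam * P⁻¹)
    (hcols : ∀ j, Real.sqrt (∑ i, P i j ^ 2) = 1)
    (hspec : ∀ i, lam i < 1 - 2 * α * μ / 3) :
    ∀ k : ℕ,
      max ((1 / n : ℝ) * sqFrob (Matrix.of fun a i => x i k a - xstar a))
          ((1 / n : ℝ) * sqFrob
            (Matrix.of fun a i => x i k a - (1 / n : ℝ) * ∑ j, x j k a)) ≤
        3 * (specNorm P * specNorm P⁻¹) * (1 - 2 * α * μ / 3) ^ k *
          (sqVec (fun a => (1 / n : ℝ) * (∑ i, x i 0 a) - xstar a) +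
            (sqFrob (Matrix.of fun a i => x i 0 a) +
              sqFrob (Matrix.of fun a i => s i 0 a)) / n) := by
  set τ := 1 - 2 * α * μ / 3 with hτ
  set κ := (1 + ρ ^ 2) / (1 - ρ ^ 2) with hκ
  set η := τ - (1 + ρ ^ 2) / 2 with hη
  set C := specNorm P * specNorm P⁻¹ with hC
  have hL : 0 < L := hμ.trans hμL
  have hn' : (0 : ℝ) < n := by exact_mod_cast hn
  obtain ⟨hκ1, hη0, hη1, hgain, hαL, hCκ⟩ :=
    small_gain_of_spectrum_lt hμ hμL hρ0 hρ1 hα P hP lam (hMt ▸ hdiag) hspec hκ hη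
  have hC1 : 1 ≤ C := one_le_specNorm_mul_specNorm_inv P hP
  have hτ0 : 0 ≤ τ := ((hlampos 0).trans (hspec 0)).le
  have hApos : ∀ i, (A i).PosSemidef := fun i => by
    simpa using (hAlow i).add (Matrix.PosSemidef.one.smul hμ.le)
  have hunit : IsUnit (∑ i, A i).det := by
    have hsum : (∑ i, (A i - μ • (1 : Matrix (Fin q) (Fin q) ℝ))).PosSemidef :=
      Matrix.posSemidef_sum _ fun i _ => hAlow i
    have hpd : (((n : ℝ) * μ) • (1 : Matrix (Fin q) (Fin q) ℝ)).PosDef :=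
      Matrix.PosDef.one.smul (by positivity)
    have h := Matrix.PosDef.posSemidef_add hsum hpd
    rw [Finset.sum_sub_distrib, Finset.sum_const, Finset.card_univ, Fintype.card_fin,
      ← Nat.cast_smul_eq_nsmul ℝ, smul_smul, sub_add_cancel] at h
    exact h.det_pos.ne'.isUnit
  have hopt : ∑ i, A i *ᵥ xstar = ∑ i, b i := by
    rw [← Matrix.sum_mulVec, hxstar, Matrix.mulVec_mulVec, Matrix.mul_nonsing_inv _ hunit,
      Matrix.one_mulVec]
  have hW : ∀ f : Fin n → ℝ, ∑ i, f i = 0 → ∑ i, (W *ᵥ f) i ^ 2 ≤ ρ ^ 2 * ∑ i, f i ^ 2 :=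
    sum_sq_mulVec_le_of_sum_eq_zero W hWrow hherm i₀ hgap ρ hρ
  have hmix : ∀ (z : Fin n → Fin q → ℝ) i a,
      (∑ j, W i j • z j) a = (W *ᵥ fun j => z j a) i := fun z i a => by
    simp [Matrix.mulVec, dotProduct]
  have hxrec' : ∀ i k a, x i (k + 1) a = (W *ᵥ fun j => x j k a) i - α * s i k a := by
    intro i k a
    rw [hxrec, Pi.sub_apply, hmix fun j => x j k]
    rfl
  have hsrec' : ∀ i k a, s i (k + 1) a = (W *ᵥ fun j => s j k a) i +
      (A i *ᵥ (x i (k + 1) - x i k)) a := by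
    intro i k a
    rw [hsrec, Pi.sub_apply, Pi.add_apply, hmix fun j => s j k, Matrix.mulVec_sub]
    simp only [Pi.sub_apply]
    ring
  have hmean : ∀ k a, ∑ i, s i k a = ∑ i, (A i *ᵥ (x i k - xstar)) a := by
    intro k a
    induction k with
    | zero =>
      have h := congrFun hopt a
      simp only [Finset.sum_apply] at h
      simp only [hs0, Matrix.mulVec_sub, Pi.sub_apply, Finset.sum_sub_distrib, h]
    | succ k ih =>
      simp only [hsrec', Finset.sum_add_distrib, sum_mulVec_of_col_sum W hWcol, ih]
      rw [← Finset.sum_add_distrib]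
      refine Finset.sum_congr rfl fun i _ => ?_
      rw [← Pi.add_apply, ← Matrix.mulVec_add, sub_add_sub_cancel']
  let w : ℕ → Fin q → ℝ := fun k a => (1 / n : ℝ) * (∑ i, x i k a) - xstar a
  let sb : ℕ → Fin q → ℝ := fun k a => (1 / n : ℝ) * ∑ i, s i k a
  let D : ℕ → ℝ := fun k => ∑ a, sqDev fun i => x i k a
  let E : ℕ → ℝ := fun k => ∑ a, sqDev fun i => s i k a
  have hD : ∀ k, 0 ≤ D k := fun k => Finset.sum_nonneg fun a _ => sqDev_nonneg _
  have hE : ∀ k, 0 ≤ E k := fun k => Finset.sum_nonneg fun a _ => sqDev_nonneg _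
  have hX : ∀ k, 0 ≤ n * sqVec (w k) := fun k =>
    mul_nonneg hn'.le (Finset.sum_nonneg fun a _ => sq_nonneg _)
  set B := 6 / 5 * (κ * α ^ 2) / η with hB
  have hB0 : 0 ≤ B := by positivity
  have hstep : ∀ k, n * sqVec (w (k + 1)) + D (k + 1) + B * E (k + 1) ≤
      τ * (n * sqVec (w k) + D k + B * E k) := by
    intro k
    have hwk : w (k + 1) = w k - α • sb k := by
      ext a
      simp only [w, sb, hxrec', Finset.sum_sub_distrib, sum_mulVec_of_col_sum W hWcol,
        ← Finset.mul_sum, Pi.sub_apply, Pi.smul_apply, smul_eq_mul]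
      ring
    have h1 := sqVec_mean_step_le hn hL hAsymm hApos hAlow hAupp hα (fun i => x i k) xstar
      (w k) (sb k) (fun _ => rfl) fun a => by simp only [sb, hmean]
    rw [← hwk] at h1
    have hG : 0 ≤ ∑ i, (x i k - xstar) ⬝ᵥ A i *ᵥ (x i k - xstar) :=
      Finset.sum_nonneg fun i _ => by
        simpa using (hApos i).dotProduct_mulVec_nonneg (x i k - xstar)
    have h2 := sum_sqDev_step_le hn W hWrow hWcol hρ0 hρ1 hW (fun i => x i k)
      (fun i => x i (k + 1)) (fun i a => -α * s i k a) fun i a => by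
        rw [hxrec']
        ring
    simp only [sqDev_const_mul, neg_sq, ← Finset.mul_sum] at h2
    have h3 := sum_sqDev_step_le hn W hWrow hWcol hρ0 hρ1 hW (fun i => s i k)
      (fun i => s i (k + 1)) (fun i => A i *ᵥ (x i (k + 1) - x i k)) fun i a => hsrec' i k a
    have h4 := sum_sq_gradient_increment_le hn hL hAsymm hApos hAupp W hWrow hWcol
      (by nlinarith : ρ ^ 2 ≤ 1) hW α (fun i => x i k) (fun i => s i k) (fun i => x i (k + 1))
      (sb k) (fun _ => rfl) fun i a => hxrec' i k a
    have hτη : (1 + ρ ^ 2) / 2 = τ - η := by rw [hη]; ring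
    rw [hτη] at h2 h3
    exact lyapunov_step hL hα hμ hκ1 hη0 hη1 hgain hαL hτ (hX k) (hD k) (hE k) hG h1.1 h1.2 h2
      (h3.trans (add_le_add_right (mul_le_mul_of_nonneg_left h4 (by positivity)) _))
  have hpow : ∀ k, n * sqVec (w k) + D k + B * E k ≤
      τ ^ k * (n * sqVec (w 0) + D 0 + B * E 0) := by
    intro k
    induction k with
    | zero => simp
    | succ k ih =>
      rw [pow_succ', mul_assoc]
      exact (hstep k).trans (mul_le_mul_of_nonneg_left ih hτ0)
  have hBC : B ≤ 3 * C := by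
    rw [hB, div_le_iff₀ hη0]
    nlinarith [mul_pos (one_pos.trans_le hC1) hη0]
  have hfrob : ∀ z : Fin n → Fin q → ℝ,
      ∑ a, sqDev (fun i => z i a) ≤ sqFrob (Matrix.of fun a i => z i a) := fun z =>
    Finset.sum_le_sum fun a _ => sqDev_le_sum_sq hn _
  have hinit : n * sqVec (w 0) + D 0 + B * E 0 ≤ 3 * C * (n * sqVec (w 0) +
      (sqFrob (Matrix.of fun a i => x i 0 a) + sqFrob (Matrix.of fun a i => s i 0 a))) := by
    have h1 : 1 * (n * sqVec (w 0)) ≤ 3 * C * (n * sqVec (w 0)) :=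
      mul_le_mul_of_nonneg_right (by linarith) (hX 0)
    have h2 : 1 * D 0 ≤ 3 * C * sqFrob (Matrix.of fun a i => x i 0 a) :=
      mul_le_mul (by linarith) (hfrob fun i => x i 0) (hD 0) (by linarith)
    have h3 : B * E 0 ≤ 3 * C * sqFrob (Matrix.of fun a i => s i 0 a) :=
      mul_le_mul hBC (hfrob fun i => s i 0) (hE 0) (by linarith)
    linarith
  intro k
  have hdist : sqFrob (Matrix.of fun a i => x i k a - xstar a) = n * sqVec (w k) + D k := by
    simp only [sqFrob, Matrix.of_apply, sum_sq_sub_eq hn, Finset.sum_add_distrib,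
      ← Finset.mul_sum]
    exact add_comm _ _
  have hcons : sqFrob (Matrix.of fun a i => x i k a - (1 / n : ℝ) * ∑ j, x j k a) = D k := rfl
  rw [hdist, hcons]
  have hbound : (1 / n : ℝ) * (n * sqVec (w k) + D k) ≤ 3 * C * τ ^ k * (sqVec (w 0) +
      (sqFrob (Matrix.of fun a i => x i 0 a) + sqFrob (Matrix.of fun a i => s i 0 a)) / n) := by
    have h1 : n * sqVec (w k) + D k ≤ τ ^ k * (3 * C * (n * sqVec (w 0) +
        (sqFrob (Matrix.of fun a i => x i 0 a) + sqFrob (Matrix.of fun a i => s i 0 a)))) :=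
      (le_add_of_nonneg_right (mul_nonneg hB0 (hE k))).trans
        ((hpow k).trans (mul_le_mul_of_nonneg_left hinit (pow_nonneg hτ0 k)))
    refine (mul_le_mul_of_nonneg_left h1 (by positivity)).trans_eq ?_
    field_simp
  refine max_le hbound (le_trans ?_ hbound)
  exact mul_le_mul_of_nonneg_left (le_add_of_nonneg_left (hX k)) (by positivity)
end

section
/- Let \rho \in [0,1), and let \sigma_{g,1}, \delta, L_{g,1}, \sigma_x \ge 0 be constants. Let \{\alpha_k\}_{k\ge 0} be nonnegative reals and \{\beta_k\}_{k\ge 0} satisfy 0 < \beta_k \le 1 for all k. Define \tilde{\alpha}_0^2 = 0, \tilde{\alpha}_{k+1}^2 = \sum_{i=0}^{k} \alpha_i^2 (\frac{1+\rho^2}{2})^{k-i}, and \tilde{\beta}_0^2 = 0, \tilde{\beta}_{k+1}^2 = \frac{1+\rho^2}{1-\rho^2} \sum_{i=0}^{k} \beta_i^2 (2\sigma_{g,1}^2 + 6 L_{g,1}^2 \sigma_x^2 \tilde{\alpha}_i^2 + 3\delta^2)(\frac{3+\rho^2}{4})^{k-i}. Then for every K \ge 0, \sum_{k=0}^{K}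 \tilde{\beta}_{k+1}^2 \le \frac{4(1+\rho^2)}{(1-\rho^2)^2}\Big[ (10\sigma_{g,1}^2 + 5\delta^2)\sum_{i=0}^{K}\beta_i^2 + \frac{20 L_{g,1}^2 \sigma_x^2}{1-\rho^2}\sum_{i=0}^{K-1}\alpha_i^2 \Big]. -/
/-- The geometric convolution `y k = ∑ i ≤ k, c i * r ^ (k - i)` satisfies
`(1 - r) ∑ k ≤ n, y k + r * y n = ∑ i ≤ n, c i`. -/
theorem one_sub_mul_sum_geom_conv_add (c : ℕ → ℝ) (r : ℝ) (n : ℕ) :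
    (1 - r) * ∑ k ∈ Finset.range (n + 1), ∑ i ∈ Finset.range (k + 1), c i * r ^ (k - i) +
      r * ∑ i ∈ Finset.range (n + 1), c i * r ^ (n - i) =
      ∑ i ∈ Finset.range (n + 1), c i := by
  induction n with
  | zero => simp; ring
  | succ n ih =>
    have hstep : ∑ i ∈ Finset.range (n + 1 + 1), c i * r ^ (n + 1 - i) =
        r * ∑ i ∈ Finset.range (n + 1), c i * r ^ (n - i) + c (n + 1) := by
      rw [Finset.sum_range_succ, Finset.mul_sum, Nat.sub_self, pow_zero, mul_one]
      congr 1
      refine Finset.sum_congr rfl fun i hi => ?_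
      rw [Nat.sub_add_comm (Finset.mem_range_succ_iff.mp hi), pow_succ]
      ring
    rw [Finset.sum_range_succ _ (n + 1), hstep, Finset.sum_range_succ c (n + 1)]
    linear_combination ih

theorem sum_geom_conv_le {c : ℕ → ℝ} (hc : ∀ i, 0 ≤ c i) {r : ℝ} (hr0 : 0 ≤ r) (hr1 : r < 1)
    (n : ℕ) :
    ∑ k ∈ Finset.range n, ∑ i ∈ Finset.range (k + 1), c i * r ^ (k - i) ≤
      (∑ i ∈ Finset.range n, c i) / (1 - r) := by
  rw [le_div_iff₀' (sub_pos.mpr hr1)]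
  cases n with
  | zero => simp
  | succ n =>
    rw [← one_sub_mul_sum_geom_conv_add c r n]
    exact le_add_of_nonneg_right
      (mul_nonneg hr0 (Finset.sum_nonneg fun i _ => mul_nonneg (hc i) (pow_nonneg hr0 _)))

/-- Summability bound for the sequence `tβ` defined by
`tβ 0 = 0`, `tβ (k+1) = ((1+ρ²)/(1-ρ²)) ∑_{i=0}^{k} β_i² (2σ_{g,1}² + 6L_{g,1}²σ_x² tα_i + 3δ²)((3+ρ²)/4)^{k-i}`,
where `tα 0 = 0` and `tα (k+1) = ∑_{i=0}^{k} α_i² ((1+ρ²)/2)^{k-i}`. -/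
theorem stmt_16 (ρ : ℝ) (hρ0 : 0 ≤ ρ) (hρ1 : ρ < 1)
    (σg1 δ Lg1 σx : ℝ) (hσg1 : 0 ≤ σg1) (hδ : 0 ≤ δ) (hLg1 : 0 ≤ Lg1) (hσx : 0 ≤ σx)
    (α β : ℕ → ℝ) (hα : ∀ k, 0 ≤ α k) (hβ : ∀ k, 0 < β k ∧ β k ≤ 1)
    (tα tβ : ℕ → ℝ) (htα0 : tα 0 = 0)
    (htαrec : ∀ k, tα (k + 1) =
      ∑ i ∈ Finset.range (k + 1), α i ^ 2 * ((1 + ρ ^ 2) / 2) ^ (k - i))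
    (htβ0 : tβ 0 = 0)
    (htβrec : ∀ k, tβ (k + 1) = (1 + ρ ^ 2) / (1 - ρ ^ 2) *
      ∑ i ∈ Finset.range (k + 1),
        β i ^ 2 * (2 * σg1 ^ 2 + 6 * Lg1 ^ 2 * σx ^ 2 * tα i + 3 * δ ^ 2) *
          ((3 + ρ ^ 2) / 4) ^ (k - i)) :
    ∀ K, ∑ k ∈ Finset.range (K + 1), tβ (k + 1) ≤
      4 * (1 + ρ ^ 2) / (1 - ρ ^ 2) ^ 2 *
        ((10 * σg1 ^ 2 + 5 * δ ^ 2) * ∑ i ∈ Finset.range (K + 1), β i ^ 2 +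
          20 * Lg1 ^ 2 * σx ^ 2 / (1 - ρ ^ 2) * ∑ i ∈ Finset.range K, α i ^ 2) := by
  intro K
  have hD : 0 < 1 - ρ ^ 2 := by nlinarith
  have htα : ∀ i, 0 ≤ tα i := by
    rintro (_ | k)
    · exact htα0.ge
    · rw [htαrec]
      positivity
  have hsumα : ∑ i ∈ Finset.range (K + 1), tα i ≤
      2 / (1 - ρ ^ 2) * ∑ i ∈ Finset.range K, α i ^ 2 := by
    rw [Finset.sum_range_succ', htα0, add_zero]
    simp only [htαrec]
    refine (sum_geom_conv_le (fun i => sq_nonneg (α i)) (r := (1 + ρ ^ 2) / 2)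
      (by positivity) (by linarith) K).trans_eq ?_
    rw [show 1 - (1 + ρ ^ 2) / 2 = (1 - ρ ^ 2) / 2 by ring]
    field_simp
  set c : ℕ → ℝ := fun i =>
    β i ^ 2 * (2 * σg1 ^ 2 + 6 * Lg1 ^ 2 * σx ^ 2 * tα i + 3 * δ ^ 2) with hc
  have hc0 : ∀ i, 0 ≤ c i := fun i => by
    have := htα i
    positivity
  have hsumβ : ∑ k ∈ Finset.range (K + 1), tβ (k + 1) ≤
      4 * (1 + ρ ^ 2) / (1 - ρ ^ 2) ^ 2 * ∑ i ∈ Finset.range (K + 1), c i := by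
    simp only [htβrec]
    rw [← Finset.mul_sum]
    refine (mul_le_mul_of_nonneg_left (sum_geom_conv_le hc0 (r := (3 + ρ ^ 2) / 4)
      (by positivity) (by linarith) (K + 1)) (by positivity)).trans_eq ?_
    rw [show 1 - (3 + ρ ^ 2) / 4 = (1 - ρ ^ 2) / 4 by ring]
    field_simp
  refine hsumβ.trans (mul_le_mul_of_nonneg_left ?_ (by positivity))
  have hc_le : ∀ i, c i ≤
      (10 * σg1 ^ 2 + 5 * δ ^ 2) * β i ^ 2 + 10 * Lg1 ^ 2 * σx ^ 2 * tα i := fun i => by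
    have hβ1 : β i ^ 2 ≤ 1 := pow_le_one₀ (hβ i).1.le (hβ i).2
    have hA : 0 ≤ Lg1 ^ 2 * σx ^ 2 * tα i := mul_nonneg (by positivity) (htα i)
    have hB : 0 ≤ (8 * σg1 ^ 2 + 2 * δ ^ 2) * β i ^ 2 := by positivity
    have hC := mul_le_mul_of_nonneg_right hβ1 hA
    simp only [hc]
    linarith
  calc ∑ i ∈ Finset.range (K + 1), c i
      ≤ (10 * σg1 ^ 2 + 5 * δ ^ 2) * ∑ i ∈ Finset.range (K + 1), β i ^ 2 +
          10 * Lg1 ^ 2 * σx ^ 2 * ∑ i ∈ Finset.range (K + 1), tα i := by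
        rw [Finset.mul_sum, Finset.mul_sum, ← Finset.sum_add_distrib]
        exact Finset.sum_le_sum fun i _ => hc_le i
    _ ≤ (10 * σg1 ^ 2 + 5 * δ ^ 2) * ∑ i ∈ Finset.range (K + 1), β i ^ 2 +
          10 * Lg1 ^ 2 * σx ^ 2 * (2 / (1 - ρ ^ 2) * ∑ i ∈ Finset.range K, α i ^ 2) := by
        gcongr
    _ = _ := by ring
end
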